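/- arXiv:2007.06964 — 2 statements merged into one kernel-verified Lean document; each statement's English description precedes it below -/
import Mathlib

section
/- Product rule along cone curves: Let V ⊂ ℝ^d be the closure of a bounded domain, let ρ_t = h(t)δ_{γ(t)} ∈ H_V, and let b ∈ C¹(V). Then the function t ↦ h(t)b(γ(t)) belongs to AC²[0,1] and satisfies (h(t)b(γ(t)))' = h'(t)b(γ(t)) + h(t)∇b(γ(t))·γ'(t) for a.e. t ∈ (0,1). -/
open MeasureTheory Set Filter Topology
open scoped ENNReal NNReal

noncomputable section

namespace Paper

abbrev Euc (d : ℕ) : Type := EuclideanSpace ℝ (Fin d)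

abbrev XX (d : ℕ) : Type := ℝ × Euc d

variable {d : ℕ}

/-- `Ω` is the closure of a bounded domain (a nonempty bounded open connected set). -/
def IsClosureOfBoundedDomain (Ω : Set (Euc d)) : Prop :=
  ∃ U : Set (Euc d), IsOpen U ∧ U.Nonempty ∧ IsConnected U ∧
    Bornology.IsBounded U ∧ Ω = closure U

/-- `Ω` is the closure of a bounded convex domain. -/
def IsClosureOfBoundedConvexDomain (Ω : Set (Euc d)) : Prop :=
  ∃ U : Set (Euc d), IsOpen U ∧ U.Nonempty ∧ Convex ℝ U ∧
    Bornology.IsBounded U ∧ Ω = closure U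

/-- clamping of `ℝ` onto `[0,1]`. -/
def clamp (t : ℝ) : ℝ := max 0 (min 1 t)

/-- `t ↦ ρ t` is a narrowly continuous curve (on `[0,1]`) of finite positive
measures concentrated on `Ω`, i.e. an element of `C_w([0,1]; M⁺(Ω))`. -/
def NarrowCurve (Ω : Set (Euc d)) (ρ : ℝ → Measure (Euc d)) : Prop :=
  (∀ t ∈ Icc (0:ℝ) 1, ρ t Ωᶜ = 0 ∧ ρ t Set.univ ≠ ⊤) ∧
  (∀ φ : Euc d → ℝ, Continuous φ →
      ContinuousOn (fun t => ∫ x, φ x ∂(ρ t)) (Icc (0:ℝ) 1))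

/-- Test functions for the continuity equation on `X_Ω = (0,1) × Ω` (no-flux form:
compact support in time, free at the spatial boundary). -/
def IsTest (φ : XX d → ℝ) : Prop :=
  ContDiff ℝ (⊤ : ℕ∞) φ ∧ HasCompactSupport φ ∧
    tsupport φ ⊆ Ioo (0:ℝ) 1 ×ˢ (Set.univ : Set (Euc d))

/-- Distributional solution of `∂ₜ ρ + div (v ρ) = g ρ`. -/
def SolvesCE (ρ : ℝ → Measure (Euc d)) (v : XX d → Euc d) (g : XX d → ℝ) : Prop :=
  ∀ φ : XX d → ℝ, IsTest φ →
    (∫ t in Ioo (0:ℝ) 1,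
      ∫ x, (fderiv ℝ φ (t, x) (1, v (t, x)) + φ (t, x) * g (t, x)) ∂(ρ t)) = 0

/-- The Hellinger–Kantorovich energy `∫₀¹ ∫ (|v|² + g²) dρ_t dt`. -/
def EnergyVG (ρ : ℝ → Measure (Euc d)) (v : XX d → Euc d) (g : XX d → ℝ) : ℝ≥0∞ :=
  ∫⁻ t in Ioo (0:ℝ) 1, ∫⁻ x, ENNReal.ofReal (‖v (t, x)‖ ^ 2 + g (t, x) ^ 2) ∂(ρ t)

/-- The class `D_{v,g}` of finite-energy narrowly continuous solutions. -/
def Dvg (Ω : Set (Euc d)) (v : XX d → Euc d) (g : XX d → ℝ)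
    (ρ : ℝ → Measure (Euc d)) : Prop :=
  NarrowCurve Ω ρ ∧ SolvesCE ρ v g ∧ EnergyVG ρ v g < ⊤

/-- total variation `‖ρ‖_{M(X_Ω)}` of `ρ = dt ⊗ ρ_t`. -/
def TVcurve (ρ : ℝ → Measure (Euc d)) : ℝ≥0∞ :=
  ∫⁻ t in Ioo (0:ℝ) 1, ρ t Set.univ

/-- The cone `𝒞_V = {h δ_γ : h ≥ 0, γ ∈ V}` of weighted Dirac masses. -/
def coneSet (V : Set (Euc d)) : Set (Measure (Euc d)) :=
  {μ | ∃ (a : ℝ) (x : Euc d), 0 ≤ a ∧ x ∈ V ∧ μ = ENNReal.ofReal a • Measure.dirac x}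

/-- The space `𝒮_V` of narrowly continuous curves `[0,1] → 𝒞_V`
(extended to `ℝ` by clamping). -/
structure SCurve (V : Set (Euc d)) where
  toFun : ℝ → Measure (Euc d)
  clamped : ∀ t, toFun t = toFun (clamp t)
  cone : ∀ t, toFun t ∈ coneSet V
  narrow : ∀ φ : Euc d → ℝ, Continuous φ → Continuous fun t => ∫ x, φ x ∂(toFun t)

/-- The flat distance `D_F` between measures. -/
def flatDist (μ ν : Measure (Euc d)) : ℝ :=
  sSup {r : ℝ | ∃ φ : Euc d → ℝ, Continuous φ ∧ (∀ x, |φ x| ≤ 1) ∧ LipschitzWith 1 φ ∧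
        r = (∫ x, φ x ∂μ) - ∫ x, φ x ∂ν}

/-- The supremum distance `D` on `𝒮_V`. -/
def Ddist {V : Set (Euc d)} (η₁ η₂ : SCurve V) : ℝ :=
  sSup {r : ℝ | ∃ t ∈ Icc (0:ℝ) 1, r = flatDist (η₁.toFun t) (η₂.toFun t)}

/-- The topology of `(𝒮_V, D)`, generated by the open `D`-balls. -/
def Stop (V : Set (Euc d)) : TopologicalSpace (SCurve V) :=
  TopologicalSpace.generateFrom
    {s | ∃ (η₀ : SCurve V) (ε : ℝ), 0 < ε ∧ s = {η | Ddist η₀ η < ε}}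

/-- The Borel σ-algebra of `(𝒮_V, D)`. -/
def Sborel (V : Set (Euc d)) : MeasurableSpace (SCurve V) := @borel _ (Stop V)

instance (V : Set (Euc d)) : MeasurableSpace (SCurve V) := Sborel V

/-- `‖h‖_∞` for a curve `ρ_t = h(t) δ_{γ(t)} ∈ 𝒮_V`. -/
def supMass {V : Set (Euc d)} (η : SCurve V) : ℝ≥0∞ :=
  ⨆ t ∈ Icc (0:ℝ) 1, η.toFun t Set.univ

/-- `AC²[0,1]`: absolutely continuous on `[0,1]` with a.e. derivative in `L²`. -/
def AC2 {F : Type*} [NormedAddCommGroup F] [NormedSpace ℝ F] (f : ℝ → F) : Prop :=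
  ∃ f' : ℝ → F, IntegrableOn f' (Icc (0:ℝ) 1) ∧
    IntegrableOn (fun t => ‖f' t‖ ^ 2) (Icc (0:ℝ) 1) ∧
    ∀ t ∈ Icc (0:ℝ) 1, f t = f 0 + ∫ s in (0:ℝ)..t, f' s

/-- `(γ, h)` represents the curve `η ∈ 𝒮_V`, i.e. `η_t = h(t) δ_{γ(t)}` on `[0,1]`. -/
def Represents {V : Set (Euc d)} (η : SCurve V) (γ : ℝ → Euc d) (h : ℝ → ℝ) : Prop :=
  ∀ t ∈ Icc (0:ℝ) 1, 0 ≤ h t ∧ γ t ∈ V ∧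
    η.toFun t = ENNReal.ofReal (h t) • Measure.dirac (γ t)

/-- The set `H_V ⊆ 𝒮_V` of curves `h(t)δ_{γ(t)}` with `h, √h ∈ AC²[0,1]`,
`√h γ ∈ AC²([0,1];ℝ^d)`. -/
def MemH (V : Set (Euc d)) (η : SCurve V) : Prop :=
  ∃ (γ : ℝ → Euc d) (h : ℝ → ℝ), Represents η γ h ∧ AC2 h ∧
    AC2 (fun t => Real.sqrt (h t)) ∧ AC2 (fun t => Real.sqrt (h t) • γ t)

/-- The set `H_V^{v,g}`: curves in `H_V` solving the characteristic system
`γ' = v(t,γ)` a.e. on `{h>0}` and `h' = g(t,γ) h` a.e. on `(0,1)`. -/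
def MemHvg (V : Set (Euc d)) (v : XX d → Euc d) (g : XX d → ℝ) (η : SCurve V) : Prop :=
  ∃ (γ : ℝ → Euc d) (h : ℝ → ℝ), Represents η γ h ∧ AC2 h ∧
    AC2 (fun t => Real.sqrt (h t)) ∧ AC2 (fun t => Real.sqrt (h t) • γ t) ∧
    (∀ᵐ t ∂(volume.restrict {t | t ∈ Ioo (0:ℝ) 1 ∧ 0 < h t}),
        HasDerivAt γ (v (t, γ t)) t) ∧
    (∀ᵐ t ∂(volume.restrict (Ioo (0:ℝ) 1)),
        HasDerivAt h (g (t, γ t) * h t) t)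

/-- The set `𝒮*_V` of curves whose positivity set `{h > 0}` is `[0,1] ∩ (-∞, τ)`. -/
def MemSstar {V : Set (Euc d)} (η : SCurve V) : Prop :=
  ∃ τ : ℝ, {t | t ∈ Icc (0:ℝ) 1 ∧ η.toFun t Set.univ ≠ 0} = Icc (0:ℝ) 1 ∩ Iio τ

/-- The vanishing time `τ(γ,h) = min { t ∈ [0,1] : h(t) = 0 }` (`∞` if none). -/
def tauS {V : Set (Euc d)} (η : SCurve V) : ℝ≥0∞ :=
  sInf {c : ℝ≥0∞ | ∃ t ∈ Icc (0:ℝ) 1, η.toFun t Set.univ = 0 ∧ c = ENNReal.ofReal t}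


open Classical in
/-- The integrand `Ψ_δ(t,x,y)`. -/
def Psi (δ : ℝ) (t : ℝ) (x : Euc d) (y : ℝ) : ℝ≥0∞ :=
  if 0 < t then ENNReal.ofReal ((‖x‖ ^ 2 + δ ^ 2 * y ^ 2) / (2 * t))
  else if t = 0 ∧ x = 0 ∧ y = 0 then 0 else ⊤

/-- `u` is a density of the signed measure `σ` with respect to `lam`. -/
def IsDensityS (σ : SignedMeasure (XX d)) (lam : Measure (XX d)) (u : XX d → ℝ) : Prop :=
  ∀ s : Set (XX d), MeasurableSet s → σ s = ∫ x in s, u x ∂lam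

/-- `w` is a density of the vector measure `m` with respect to `lam`. -/
def IsDensityV (m : VectorMeasure (XX d) (Euc d)) (lam : Measure (XX d))
    (w : XX d → Euc d) : Prop :=
  ∀ s : Set (XX d), MeasurableSet s → m s = ∫ x in s, w x ∂lam

/-- `r` is a density of the positive measure `P` with respect to `lam`. -/
def IsDensityP (P : Measure (XX d)) (lam : Measure (XX d)) (r : XX d → ℝ) : Prop :=
  ∀ s : Set (XX d), MeasurableSet s → P s = ∫⁻ x in s, ENNReal.ofReal (r x) ∂lam

/-- `(P, m, μ)` is a measure solution of `∂ₜ ρ + div m = μ` (with `P` positive). -/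
def SolvesCEMeas (P : Measure (XX d)) (m : VectorMeasure (XX d) (Euc d))
    (μ : SignedMeasure (XX d)) : Prop :=
  ∀ (lam : Measure (XX d)), IsFiniteMeasure lam →
    ∀ (w : XX d → Euc d) (u : XX d → ℝ), Measurable w → Measurable u →
      IsDensityV m lam w → IsDensityS μ lam u →
      ∀ φ : XX d → ℝ, IsTest φ →
        ((∫ x, fderiv ℝ φ x ((1:ℝ), (0 : Euc d)) ∂P) +
          (∫ x, fderiv ℝ φ x ((0:ℝ), w x) ∂lam) + ∫ x, φ x * u x ∂lam) = 0

/-- The Wasserstein–Fisher–Rao energy `B_δ(ρ,m,μ)` for a positive `ρ`. -/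
def BdeltaMeas (δ : ℝ) (P : Measure (XX d)) (m : VectorMeasure (XX d) (Euc d))
    (μ : SignedMeasure (XX d)) : ℝ≥0∞ :=
  sInf {c : ℝ≥0∞ | ∃ lam : Measure (XX d), IsFiniteMeasure lam ∧
    ∃ (r : XX d → ℝ) (w : XX d → Euc d) (u : XX d → ℝ),
      Measurable r ∧ Measurable w ∧ Measurable u ∧ (∀ x, 0 ≤ r x) ∧
      IsDensityP P lam r ∧ IsDensityV m lam w ∧ IsDensityS μ lam u ∧
      c = ∫⁻ x, Psi δ (r x) (w x) (u x) ∂lam}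

open Classical in
/-- The coercive energy `J_{α,β,δ}(ρ,m,μ)` for a positive `ρ`. -/
def JMeas (α β δ : ℝ) (P : Measure (XX d)) (m : VectorMeasure (XX d) (Euc d))
    (μ : SignedMeasure (XX d)) : ℝ≥0∞ :=
  if SolvesCEMeas P m μ then
    ENNReal.ofReal β * BdeltaMeas δ P m μ + ENNReal.ofReal α * P Set.univ
  else ⊤

/-- `(ρ, m, μ)` is a measure solution of `∂ₜ ρ + div m = μ` (signed case). -/
def SolvesCESigned (ρ : SignedMeasure (XX d)) (m : VectorMeasure (XX d) (Euc d))
    (μ : SignedMeasure (XX d)) : Prop :=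
  ∀ (lam : Measure (XX d)), IsFiniteMeasure lam →
    ∀ (r : XX d → ℝ) (w : XX d → Euc d) (u : XX d → ℝ),
      Measurable r → Measurable w → Measurable u →
      IsDensityS ρ lam r → IsDensityV m lam w → IsDensityS μ lam u →
      ∀ φ : XX d → ℝ, IsTest φ →
        (∫ x, (fderiv ℝ φ x ((1:ℝ), (0 : Euc d)) * r x
          + fderiv ℝ φ x ((0:ℝ), w x) + φ x * u x) ∂lam) = 0

/-- The Wasserstein–Fisher–Rao energy `B_δ(ρ,m,μ)`, signed case. -/
def BdeltaSigned (δ : ℝ) (ρ : SignedMeasure (XX d)) (m : VectorMeasure (XX d) (Euc d))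
    (μ : SignedMeasure (XX d)) : ℝ≥0∞ :=
  sInf {c : ℝ≥0∞ | ∃ lam : Measure (XX d), IsFiniteMeasure lam ∧
    ∃ (r : XX d → ℝ) (w : XX d → Euc d) (u : XX d → ℝ),
      Measurable r ∧ Measurable w ∧ Measurable u ∧
      IsDensityS ρ lam r ∧ IsDensityV m lam w ∧ IsDensityS μ lam u ∧
      c = ∫⁻ x, Psi δ (r x) (w x) (u x) ∂lam}

open Classical in
/-- The coercive energy `J_{α,β,δ}(ρ,m,μ)`, signed case. -/
def JSigned (α β δ : ℝ) (ρ : SignedMeasure (XX d)) (m : VectorMeasure (XX d) (Euc d))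
    (μ : SignedMeasure (XX d)) : ℝ≥0∞ :=
  if SolvesCESigned ρ m μ then
    ENNReal.ofReal β * BdeltaSigned δ ρ m μ
      + ENNReal.ofReal α * ρ.totalVariation Set.univ
  else ⊤

/-- A signed measure on `X = ℝ × ℝ^d` is concentrated on `X_Ω = (0,1) × Ω`. -/
def ConcS (Ω : Set (Euc d)) (ρ : SignedMeasure (XX d)) : Prop :=
  ∀ s : Set (XX d), MeasurableSet s → s ⊆ (Ioo (0:ℝ) 1 ×ˢ Ω)ᶜ → ρ s = 0

/-- A vector measure on `X = ℝ × ℝ^d` is concentrated on `X_Ω = (0,1) × Ω`. -/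
def ConcV (Ω : Set (Euc d)) (m : VectorMeasure (XX d) (Euc d)) : Prop :=
  ∀ s : Set (XX d), MeasurableSet s → s ⊆ (Ioo (0:ℝ) 1 ×ˢ Ω)ᶜ → m s = 0

/-- Integral of `φ` against a signed measure. -/
def sInt {α : Type*} [MeasurableSpace α] (σ : SignedMeasure α) (φ : α → ℝ) : ℝ :=
  (∫ x, φ x ∂σ.toJordanDecomposition.posPart) -
    ∫ x, φ x ∂σ.toJordanDecomposition.negPart

/-- Triples `(ρ, m, μ) ∈ M(X_Ω) × M(X_Ω; ℝ^d) × M(X_Ω)`. -/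
abbrev Mtriple (d : ℕ) : Type :=
  SignedMeasure (XX d) × VectorMeasure (XX d) (Euc d) × SignedMeasure (XX d)

/-- `P` is the measure `dt ⊗ ρ_t` associated with the curve `η ∈ 𝒮_V`. -/
def CurveMeasure {V : Set (Euc d)} (η : SCurve V) (P : Measure (XX d)) : Prop :=
  ∀ s : Set (XX d), MeasurableSet s →
    P s = ∫⁻ t in Ioo (0:ℝ) 1, η.toFun t {x | (t, x) ∈ s}

/-- `h'` and `γ'` are the a.e. derivatives of `h` on `(0,1)` and of `γ` on `{h>0}`. -/
def HasAEDerivs (γ : ℝ → Euc d) (h : ℝ → ℝ) (γ' : ℝ → Euc d) (h' : ℝ → ℝ) : Prop :=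
  (∀ᵐ t ∂(volume.restrict (Ioo (0:ℝ) 1)), HasDerivAt h (h' t) t) ∧
  (∀ᵐ t ∂(volume.restrict {t | t ∈ Ioo (0:ℝ) 1 ∧ 0 < h t}), HasDerivAt γ (γ' t) t)

/-- The triple `p = (ρ, m, μ)` is of characteristic form
`ρ = h dt ⊗ δ_γ`, `m = γ' ρ`, `μ = h' dt ⊗ δ_γ` with the regularity of `H_Ω`. -/
def CharRepr (Ω : Set (Euc d)) (γ : ℝ → Euc d) (h : ℝ → ℝ) (γ' : ℝ → Euc d)
    (h' : ℝ → ℝ) (p : Mtriple d) : Prop :=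
  (∀ t ∈ Icc (0:ℝ) 1, 0 ≤ h t ∧ γ t ∈ Ω) ∧
  AC2 h ∧ AC2 (fun t => Real.sqrt (h t)) ∧ AC2 (fun t => Real.sqrt (h t) • γ t) ∧
  (∀ φ : Euc d → ℝ, Continuous φ →
      ContinuousOn (fun t => h t * φ (γ t)) (Icc (0:ℝ) 1)) ∧
  HasAEDerivs γ h γ' h' ∧
  (∀ s : Set (XX d), MeasurableSet s →
      p.1 s = ∫ t in Ioo (0:ℝ) 1, Set.indicator {u : ℝ | (u, γ u) ∈ s} h t) ∧
  (∀ s : Set (XX d), MeasurableSet s →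
      p.2.1 s = ∫ t in Ioo (0:ℝ) 1,
        Set.indicator {u : ℝ | (u, γ u) ∈ s} (fun u => h u • γ' u) t) ∧
  (∀ s : Set (XX d), MeasurableSet s →
      p.2.2 s = ∫ t in Ioo (0:ℝ) 1, Set.indicator {u : ℝ | (u, γ u) ∈ s} h' t)

/-- The set `𝒞` of extremal characteristic triples. -/
def MemC (α β δ : ℝ) (Ω : Set (Euc d)) (p : Mtriple d) : Prop :=
  ∃ (γ : ℝ → Euc d) (h : ℝ → ℝ) (γ' : ℝ → Euc d) (h' : ℝ → ℝ),
    CharRepr Ω γ h γ' h' p ∧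
    IsPreconnected {t | t ∈ Icc (0:ℝ) 1 ∧ 0 < h t} ∧
    JSigned α β δ p.1 p.2.1 p.2.2 = 1


/-- Curves in `C_w([0,1]; M(Ω))`: narrowly continuous curves of signed measures
concentrated on `Ω`, extended to `ℝ` by clamping. -/
def IsCwCurve (Ω : Set (Euc d)) (f : ℝ → SignedMeasure (Euc d)) : Prop :=
  (∀ t, f t = f (clamp t)) ∧
  (∀ t, ∀ s : Set (Euc d), MeasurableSet s → s ⊆ Ωᶜ → f t s = 0) ∧
  (∀ φ : Euc d → ℝ, Continuous φ → Continuous fun t => sInt (f t) φ)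

/-- `r` is a density with respect to `lam` of the measure `dt ⊗ f_t` on `X`. -/
def CwDensity (f : ℝ → SignedMeasure (Euc d)) (lam : Measure (XX d))
    (r : XX d → ℝ) : Prop :=
  ∀ s : Set (XX d), MeasurableSet s →
    (∫ t in Ioo (0:ℝ) 1,
        sInt (f t) ({x : Euc d | (t, x) ∈ s}.indicator fun _ => (1:ℝ)))
      = ∫ x in s, r x ∂lam

/-- `(f, m, μ)` is a measure solution of `∂ₜ ρ + div m = μ`, `f` a curve. -/
def SolvesCECw (f : ℝ → SignedMeasure (Euc d)) (m : VectorMeasure (XX d) (Euc d))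
    (μ : SignedMeasure (XX d)) : Prop :=
  ∀ (lam : Measure (XX d)), IsFiniteMeasure lam →
    ∀ (w : XX d → Euc d) (u : XX d → ℝ), Measurable w → Measurable u →
      IsDensityV m lam w → IsDensityS μ lam u →
      ∀ φ : XX d → ℝ, IsTest φ →
        ((∫ t in Ioo (0:ℝ) 1, sInt (f t) fun x => fderiv ℝ φ (t, x) ((1:ℝ), (0 : Euc d)))
          + (∫ x, fderiv ℝ φ x ((0:ℝ), w x) ∂lam) + ∫ x, φ x * u x ∂lam) = 0

/-- `B_δ(dt ⊗ f_t, m, μ)`. -/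
def BdeltaCw (δ : ℝ) (f : ℝ → SignedMeasure (Euc d)) (m : VectorMeasure (XX d) (Euc d))
    (μ : SignedMeasure (XX d)) : ℝ≥0∞ :=
  sInf {c : ℝ≥0∞ | ∃ lam : Measure (XX d), IsFiniteMeasure lam ∧
    ∃ (r : XX d → ℝ) (w : XX d → Euc d) (u : XX d → ℝ),
      Measurable r ∧ Measurable w ∧ Measurable u ∧
      CwDensity f lam r ∧ IsDensityV m lam w ∧ IsDensityS μ lam u ∧
      c = ∫⁻ x, Psi δ (r x) (w x) (u x) ∂lam}

/-- `‖dt ⊗ f_t‖_{M(X_Ω)}`. -/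
def TVCw (f : ℝ → SignedMeasure (Euc d)) : ℝ≥0∞ :=
  ∫⁻ t in Ioo (0:ℝ) 1, (f t).totalVariation Set.univ

open Classical in
/-- `J_{α,β,δ}(dt ⊗ f_t, m, μ)`. -/
def JCw (α β δ : ℝ) (f : ℝ → SignedMeasure (Euc d)) (m : VectorMeasure (XX d) (Euc d))
    (μ : SignedMeasure (XX d)) : ℝ≥0∞ :=
  if SolvesCECw f m μ then
    ENNReal.ofReal β * BdeltaCw δ f m μ + ENNReal.ofReal α * TVCw f
  else ⊤

/-- The set `𝒞` in curve form: `(f, m, μ)` with `f_t = h(t) δ_{γ(t)}`,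
`m = h γ' dt ⊗ δ_γ`, `μ = h' dt ⊗ δ_γ`, with `H_Ω`-regularity, connected
positivity set and unit energy. -/
def MemCCw (α β δ : ℝ) (Ω : Set (Euc d)) (f : ℝ → SignedMeasure (Euc d))
    (m : VectorMeasure (XX d) (Euc d)) (μ : SignedMeasure (XX d)) : Prop :=
  ∃ (γ : ℝ → Euc d) (h : ℝ → ℝ) (γ' : ℝ → Euc d) (h' : ℝ → ℝ),
    (∀ t ∈ Icc (0:ℝ) 1, 0 ≤ h t ∧ γ t ∈ Ω) ∧
    AC2 h ∧ AC2 (fun t => Real.sqrt (h t)) ∧ AC2 (fun t => Real.sqrt (h t) • γ t) ∧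
    (∀ φ : Euc d → ℝ, Continuous φ →
        ContinuousOn (fun t => h t * φ (γ t)) (Icc (0:ℝ) 1)) ∧
    HasAEDerivs γ h γ' h' ∧
    (∀ t, f t = h (clamp t) • (Measure.dirac (γ (clamp t))).toSignedMeasure) ∧
    (∀ s : Set (XX d), MeasurableSet s →
        m s = ∫ t in Ioo (0:ℝ) 1,
          Set.indicator {u : ℝ | (u, γ u) ∈ s} (fun u => h u • γ' u) t) ∧
    (∀ s : Set (XX d), MeasurableSet s →
        μ s = ∫ t in Ioo (0:ℝ) 1, Set.indicator {u : ℝ | (u, γ u) ∈ s} h' t) ∧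
    IsPreconnected {t | t ∈ Icc (0:ℝ) 1 ∧ 0 < h t} ∧
    JCw α β δ f m μ = 1

/-- The mollified density `ρ_t ∗ ξ_ε + ε χ_V`. -/
def mollDens (V : Set (Euc d)) (ρ : ℝ → Measure (Euc d)) (ξ : Euc d → ℝ) (ε : ℝ)
    (t : ℝ) (x : Euc d) : ℝ :=
  (∫ y, (ε ^ d)⁻¹ * ξ (ε⁻¹ • (x - y)) ∂(ρ t)) + ε * V.indicator (fun _ => (1:ℝ)) x

/-- The mollified measure `ρ_t^ε = (ρ_t ∗ ξ_ε + ε χ_V) dx`. -/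
def mollRho (V : Set (Euc d)) (ρ : ℝ → Measure (Euc d)) (ξ : Euc d → ℝ) (ε : ℝ) :
    ℝ → Measure (Euc d) :=
  fun t => volume.withDensity fun x => ENNReal.ofReal (mollDens V ρ ξ ε t x)

open Classical in
/-- The mollified velocity field `v^ε = ((v ρ_t) ∗ ξ_ε) / ρ_t^ε`. -/
def mollV (V : Set (Euc d)) (ρ : ℝ → Measure (Euc d)) (v : XX d → Euc d)
    (ξ : Euc d → ℝ) (ε : ℝ) : XX d → Euc d :=
  fun p => if mollDens V ρ ξ ε p.1 p.2 = 0 then 0 else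
    (mollDens V ρ ξ ε p.1 p.2)⁻¹ •
      ∫ y, ((ε ^ d)⁻¹ * ξ (ε⁻¹ • (p.2 - y))) • v (p.1, y) ∂(ρ p.1)

open Classical in
/-- The mollified growth field `g^ε = ((g ρ_t) ∗ ξ_ε) / ρ_t^ε`. -/
def mollG (V : Set (Euc d)) (ρ : ℝ → Measure (Euc d)) (g : XX d → ℝ)
    (ξ : Euc d → ℝ) (ε : ℝ) : XX d → ℝ :=
  fun p => if mollDens V ρ ξ ε p.1 p.2 = 0 then 0 else
    (mollDens V ρ ξ ε p.1 p.2)⁻¹ *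
      ∫ y, ((ε ^ d)⁻¹ * ξ (ε⁻¹ • (p.2 - y))) * g (p.1, y) ∂(ρ p.1)


lemma AC2.exists_dom {F : Type*} [NormedAddCommGroup F] [NormedSpace ℝ F]
    {f : ℝ → F} (hf : AC2 f) :
    ∃ g : ℝ → ℝ, MemLp g 2 (volume.restrict (Icc (0:ℝ) 1)) ∧
      ∀ u ∈ Icc (0:ℝ) 1, ∀ t ∈ Icc (0:ℝ) 1, u ≤ t →
        ‖f t - f u‖ ≤ ∫ s in u..t, g s := by
  obtain ⟨f', h1, h2, h3⟩ := hf
  have hm : MemLp f' 2 (volume.restrict (Icc (0:ℝ) 1)) :=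
    (memLp_two_iff_integrable_sq_norm h1.aestronglyMeasurable).2 h2
  refine ⟨fun t => ‖f' t‖, hm.norm, ?_⟩
  intro u hu t ht hut
  have hi : ∀ a ∈ Icc (0:ℝ) 1, IntervalIntegrable f' volume 0 a := by
    intro a ha
    refine (intervalIntegrable_iff_integrableOn_Icc_of_le ha.1).2 (h1.mono_set ?_)
    exact Icc_subset_Icc le_rfl ha.2
  have : f t - f u = ∫ s in u..t, f' s := by
    rw [h3 t ht, h3 u hu, add_sub_add_left_eq_sub]
    exact intervalIntegral.integral_interval_sub_left (hi t ht) (hi u hu)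
  rw [this]
  exact intervalIntegral.norm_integral_le_integral_norm hut

lemma AC2_of_dom {f G : ℝ → ℝ} (hG : MemLp G 2 (volume.restrict (Icc (0:ℝ) 1)))
    (hdom : ∀ u ∈ Icc (0:ℝ) 1, ∀ t ∈ Icc (0:ℝ) 1, u ≤ t →
        |f t - f u| ≤ ∫ s in u..t, G s) : AC2 f := by
  have hGi : IntegrableOn G (Icc (0:ℝ) 1) := hG.integrable (by norm_num)
  have hGI : IntervalIntegrable G volume 0 1 :=
    (intervalIntegrable_iff_integrableOn_Icc_of_le zero_le_one).2 hGi
  have hi : ∀ a ∈ Icc (0:ℝ) 1, IntervalIntegrable G volume 0 a := by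
    intro a ha
    refine (intervalIntegrable_iff_integrableOn_Icc_of_le ha.1).2 (hGi.mono_set ?_)
    exact Icc_subset_Icc le_rfl ha.2
  set Φ : ℝ → ℝ := fun t => ∫ s in (0:ℝ)..t, G s with hΦ
  have hd : ∀ u ∈ Icc (0:ℝ) 1, ∀ t ∈ Icc (0:ℝ) 1, |f t - f u| ≤ |Φ t - Φ u| := by
    have key : ∀ u ∈ Icc (0:ℝ) 1, ∀ t ∈ Icc (0:ℝ) 1, u ≤ t →
        |f t - f u| ≤ |Φ t - Φ u| := by
      intro u hu t ht hut
      have : Φ t - Φ u = ∫ s in u..t, G s :=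
        intervalIntegral.integral_interval_sub_left (hi t ht) (hi u hu)
      rw [this]
      exact (hdom u hu t ht hut).trans (le_abs_self _)
    intro u hu t ht
    rcases le_total u t with h | h
    · exact key u hu t ht h
    · rw [abs_sub_comm, abs_sub_comm (Φ t)]
      exact key t ht u hu h
  have hΦac : AbsolutelyContinuousOnInterval Φ 0 1 :=
    hGI.absolutelyContinuousOnInterval_intervalIntegral (by simp)
  have hfac : AbsolutelyContinuousOnInterval f 0 1 := by
    rw [absolutelyContinuousOnInterval_iff] at hΦac ⊢
    intro ε hε
    obtain ⟨δ, hδ, H⟩ := hΦac ε hε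
    refine ⟨δ, hδ, fun E hE hs => lt_of_le_of_lt ?_ (H E hE hs)⟩
    refine Finset.sum_le_sum fun i hi => ?_
    have := hE.1 i hi
    rw [uIcc_of_le zero_le_one] at this
    rw [Real.dist_eq, Real.dist_eq]
    exact hd _ this.2 _ this.1
  have hbd : ∀ᵐ t ∂(volume.restrict (Icc (0:ℝ) 1)), ‖deriv f t‖ ≤ ‖G t‖ := by
    rw [← Measure.restrict_congr_set (Ioo_ae_eq_Icc (μ := volume) (a := (0:ℝ)) (b := 1))]
    rw [ae_restrict_iff' measurableSet_Ioo]
    filter_upwards [hGI.ae_hasDerivAt_integral] with t ht ht'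
    have htI : t ∈ Icc (0:ℝ) 1 := Ioo_subset_Icc_self ht'
    have hΦd : HasDerivAt Φ (G t) t := by
      refine ht ?_ 0 (by simp)
      rwa [uIcc_of_le zero_le_one]
    by_cases hfd : DifferentiableAt ℝ f t
    · have h1 := (hasDerivAt_iff_tendsto_slope.1 hfd.hasDerivAt).norm
      have h2 := (hasDerivAt_iff_tendsto_slope.1 hΦd).norm
      refine le_of_tendsto_of_tendsto h1 h2 ?_
      filter_upwards [nhdsWithin_le_nhds (Icc_mem_nhds ht'.1 ht'.2)] with y hy
      simp only [slope_def_field, norm_div, Real.norm_eq_abs]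
      exact div_le_div_of_nonneg_right (hd t htI y hy) (abs_nonneg _)
    · rw [deriv_zero_of_not_differentiableAt hfd]
      simp
  have hfm : MemLp (deriv f) 2 (volume.restrict (Icc (0:ℝ) 1)) :=
    hG.mono (measurable_deriv f).aestronglyMeasurable hbd
  refine ⟨deriv f, hfm.integrable (by norm_num),
    (memLp_two_iff_integrable_sq_norm hfm.1).1 hfm, ?_⟩
  intro t ht
  have : AbsolutelyContinuousOnInterval f 0 t := by
    refine hfac.mono ?_
    rw [uIcc_of_le zero_le_one, uIcc_of_le ht.1]
    exact Icc_subset_Icc le_rfl ht.2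
  rw [this.integral_deriv_eq_sub]
  ring

/-- **Product rule along cone curves.**
If `ρ_t = h(t) δ_{γ(t)} ∈ H_V` and `b ∈ C¹(V)`, then `t ↦ h(t) b(γ(t))` is in
`AC²[0,1]` and `(h b∘γ)'(t) = h'(t) b(γ(t)) + h(t) ∇b(γ(t))·γ'(t)` a.e. -/
theorem product_rule_cone_curves (d : ℕ) (hd : 1 ≤ d) (V : Set (Euc d))
    (hV : IsClosureOfBoundedDomain V)
    (γ : ℝ → Euc d) (h : ℝ → ℝ) (γ' : ℝ → Euc d) (h' : ℝ → ℝ)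
    (hmem : ∀ t ∈ Icc (0:ℝ) 1, 0 ≤ h t ∧ γ t ∈ V)
    (hnarrow : ∀ φ : Euc d → ℝ, Continuous φ →
      ContinuousOn (fun t => h t * φ (γ t)) (Icc (0:ℝ) 1))
    (hh : AC2 h) (hsq : AC2 fun t => Real.sqrt (h t))
    (hsg : AC2 fun t => Real.sqrt (h t) • γ t)
    (hder : HasAEDerivs γ h γ' h')
    (b : Euc d → ℝ) (hb : ContDiff ℝ 1 b) :
    AC2 (fun t => h t * b (γ t)) ∧
    ∀ᵐ t ∂(volume.restrict (Ioo (0:ℝ) 1)),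
      HasDerivAt (fun s => h s * b (γ s))
        (h' t * b (γ t) + h t * (fderiv ℝ b (γ t)) (γ' t)) t := by
  obtain ⟨U, -, -, -, hUb, hVU⟩ := hV
  obtain ⟨R, hR0, hVR⟩ : ∃ R : ℝ, 0 ≤ R ∧ V ⊆ Metric.closedBall 0 R := by
    obtain ⟨R, hR⟩ := (Metric.isBounded_iff_subset_closedBall (0 : Euc d)).1 hUb.closure
    refine ⟨max R 0, le_max_right _ _, ?_⟩
    rw [hVU]
    exact hR.trans (Metric.closedBall_subset_closedBall (le_max_left _ _))
  have hKc : IsCompact (Metric.closedBall (0 : Euc d) R) := isCompact_closedBall _ _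
  obtain ⟨B, hB⟩ := hKc.exists_bound_of_continuousOn hb.continuous.continuousOn
  obtain ⟨L, hL⟩ := hKc.exists_bound_of_continuousOn
    (hb.continuous_fderiv one_ne_zero).continuousOn
  have h0K : (0 : Euc d) ∈ Metric.closedBall (0 : Euc d) R := by simpa using hR0
  have hB0 : 0 ≤ B := (norm_nonneg _).trans (hB 0 h0K)
  have hL0 : 0 ≤ L := (norm_nonneg _).trans (hL 0 h0K)
  have hLip : ∀ x ∈ Metric.closedBall (0 : Euc d) R, ∀ y ∈ Metric.closedBall (0 : Euc d) R,
      |b y - b x| ≤ L * ‖y - x‖ := by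
    intro x hx y hy
    exact (convex_closedBall (0 : Euc d) R).norm_image_sub_le_of_norm_fderiv_le
      (fun z _ => (hb.differentiable one_ne_zero) z) hL hx hy
  have hcont : ContinuousOn h (Icc (0:ℝ) 1) := by
    simpa using hnarrow (fun _ => 1) continuous_const
  obtain ⟨H, hH⟩ := isCompact_Icc.exists_bound_of_continuousOn hcont
  have hγK : ∀ t ∈ Icc (0:ℝ) 1, γ t ∈ Metric.closedBall (0 : Euc d) R :=
    fun t ht => hVR (hmem t ht).2
  refine ⟨?_, ?_⟩
  · obtain ⟨g1, hg1, d1⟩ := hh.exists_dom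
    obtain ⟨g2, hg2, d2⟩ := hsq.exists_dom
    obtain ⟨g3, hg3, d3⟩ := hsg.exists_dom
    set S := Real.sqrt H
    have hGm : MemLp (fun t => B * g1 t + S * L * R * g2 t + S * L * g3 t) 2
        (volume.restrict (Icc (0:ℝ) 1)) :=
      ((hg1.const_mul B).add (hg2.const_mul (S * L * R))).add (hg3.const_mul (S * L))
    refine AC2_of_dom hGm ?_
    intro u hu t ht hut
    have hii : ∀ g : ℝ → ℝ, MemLp g 2 (volume.restrict (Icc (0:ℝ) 1)) →
        IntervalIntegrable g volume u t := by
      intro g hg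
      have : IntegrableOn g (Icc (0:ℝ) 1) := hg.integrable (by norm_num)
      exact (intervalIntegrable_iff_integrableOn_Icc_of_le hut).2
        (this.mono_set (Icc_subset_Icc hu.1 ht.2))
    have e1 := hii g1 hg1
    have e2 := hii g2 hg2
    have e3 := hii g3 hg3
    rw [intervalIntegral.integral_add ((e1.const_mul _).add (e2.const_mul _)) (e3.const_mul _),
      intervalIntegral.integral_add (e1.const_mul _) (e2.const_mul _)]
    simp only [intervalIntegral.integral_const_mul]
    have f1 := d1 u hu t ht hut
    have f2 := d2 u hu t ht hut
    have f3 := d3 u hu t ht hut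
    rw [Real.norm_eq_abs] at f1 f2
    have hS0 : 0 ≤ S := Real.sqrt_nonneg _
    have hsu0 : 0 ≤ Real.sqrt (h u) := Real.sqrt_nonneg _
    have hsuS : Real.sqrt (h u) ≤ S :=
      Real.sqrt_le_sqrt ((le_abs_self _).trans (hH u hu))
    have hbt : |b (γ t)| ≤ B := hB _ (hγK t ht)
    have hγt : ‖γ t‖ ≤ R := by simpa using hγK t ht
    have hbd : |b (γ t) - b (γ u)| ≤ L * ‖γ t - γ u‖ := hLip _ (hγK u hu) _ (hγK t ht)
    have hsγ : Real.sqrt (h u) * ‖γ t - γ u‖ ≤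
        R * |Real.sqrt (h t) - Real.sqrt (h u)| +
          ‖Real.sqrt (h t) • γ t - Real.sqrt (h u) • γ u‖ := by
      have e : Real.sqrt (h u) • (γ t - γ u) =
          -((Real.sqrt (h t) - Real.sqrt (h u)) • γ t) +
            (Real.sqrt (h t) • γ t - Real.sqrt (h u) • γ u) := by
        rw [smul_sub, sub_smul]; abel
      calc Real.sqrt (h u) * ‖γ t - γ u‖ = ‖Real.sqrt (h u) • (γ t - γ u)‖ := by
            rw [norm_smul, Real.norm_eq_abs, abs_of_nonneg hsu0]
        _ ≤ _ := by
            rw [e]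
            refine (norm_add_le _ _).trans ?_
            gcongr
            rw [norm_neg, norm_smul, Real.norm_eq_abs, mul_comm]
            gcongr
    have hsq' : h u = Real.sqrt (h u) * Real.sqrt (h u) :=
      (Real.mul_self_sqrt (hmem u hu).1).symm
    calc |h t * b (γ t) - h u * b (γ u)|
        = |(h t - h u) * b (γ t) + h u * (b (γ t) - b (γ u))| := by ring_nf
      _ ≤ |h t - h u| * |b (γ t)| + h u * |b (γ t) - b (γ u)| := by
          refine (abs_add_le _ _).trans ?_
          rw [abs_mul, abs_mul, abs_of_nonneg (hmem u hu).1]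
      _ ≤ |h t - h u| * B + h u * (L * ‖γ t - γ u‖) := by
          have := (hmem u hu).1
          gcongr
      _ = |h t - h u| * B +
            Real.sqrt (h u) * L * (Real.sqrt (h u) * ‖γ t - γ u‖) := by
          nth_rewrite 1 [show h u * (L * ‖γ t - γ u‖) = (Real.sqrt (h u) * Real.sqrt (h u)) * (L * ‖γ t - γ u‖) by rw [← hsq']]
          ring
      _ ≤ (∫ s in u..t, g1 s) * B +
            S * L * (R * (∫ s in u..t, g2 s) + ∫ s in u..t, g3 s) := by
          gcongr
          refine hsγ.trans ?_
          gcongr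
      _ = _ := by ring
  · rw [ae_restrict_iff' measurableSet_Ioo]
    obtain ⟨hd1, hd2⟩ := hder
    filter_upwards [ae_imp_of_ae_restrict hd1, ae_imp_of_ae_restrict hd2] with t ht1 ht2 ht
    have htI : t ∈ Icc (0:ℝ) 1 := Ioo_subset_Icc_self ht
    have hht := ht1 ht
    rcases (hmem t htI).1.eq_or_lt with h0 | hpos
    · have hnh : Icc (0:ℝ) 1 ∈ 𝓝 t := Icc_mem_nhds ht.1 ht.2
      have hmin : IsLocalMin h t := by
        filter_upwards [hnh] with y hy
        rw [← h0]
        exact (hmem y hy).1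
      have hz : h' t = 0 := hmin.hasDerivAt_eq_zero hht
      rw [hz] at hht ⊢
      rw [← h0]
      simp only [zero_mul, add_zero]
      rw [hasDerivAt_iff_isLittleO] at hht ⊢
      simp only [← h0, smul_zero, sub_zero, zero_mul] at hht ⊢
      refine Asymptotics.IsBigO.trans_isLittleO ?_ hht
      refine Asymptotics.IsBigO.of_bound B ?_
      filter_upwards [hnh] with y hy
      rw [norm_mul, mul_comm]
      gcongr
      exact hB _ (hγK y hy)
    · have hγd := ht2 ⟨ht, hpos⟩
      have hbd : HasDerivAt (fun s => b (γ s)) (fderiv ℝ b (γ t) (γ' t)) t :=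
        ((hb.differentiable one_ne_zero) (γ t)).hasFDerivAt.comp_hasDerivAt t hγd
      exact hht.mul hbd

end Paper
end
end

section
/- Structure of finite-energy cone curves: Let V ⊂ ℝ^d be the closure of a bounded domain and α,β,δ > 0. Let ρ_t = h(t)δ_{γ(t)} ∈ 𝒮_V and (m,μ) ∈ M(X_V;ℝ^d)×M(X_V) with J_{α,β,δ}(ρ,m,μ) < ∞ (ρ := dt ⊗ ρ_t). Then: (i) there exist measurable v : X_V → ℝ^d, g : X_V → ℝ with m = vρ, μ = gρ; (ii) γ'(t) = v(t,γ(t)) for a.e. t ∈ {h>0} and h'(t) = g(t,γ(t))h(t) for a.e. t ∈ (0,1); (iii) the curve t ↦ ρ_t belongs to H_V; and J_{α,β,δ}(ρ,m,μ) = ∫_{{h>0}} ( (β/2)|γ'(t)|²h(t) + (βδ²/2)(h'(t))²/h(t) + αh(t) ) dt. Conversely, if ρ_t = h(t)δ_{γ(t)} ∈ H_V and m := h(t)γ'(t) dt ⊗ δ_{γ(t)}, μ := h'(t) dt ⊗ δ_{γ(t)}, then (ρ,m,μ) ∈ M_V is a measure solution of the continuity equation in X_V, J_{α,β,δ}(ρ,m,μ)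 < ∞, and the same formula holds. -/
open MeasureTheory Set Filter Topology
open scoped ENNReal NNReal

noncomputable section

namespace Paper

variable {d : ℕ}

/-! ### One-dimensional calculus -/

/-- `f` is a primitive of `f'` on `[0,1]`. -/
def IsPrim {F : Type*} [NormedAddCommGroup F] [NormedSpace ℝ F] (f f' : ℝ → F) : Prop :=
  IntegrableOn f' (Icc (0:ℝ) 1) ∧ ∀ t ∈ Icc (0:ℝ) 1, f t = f 0 + ∫ s in (0:ℝ)..t, f' s

section OneD

variable {E : Type*} [NormedAddCommGroup E] [NormedSpace ℝ E]

lemma IsPrim.intervalIntegrable {f f' : ℝ → E} (hf : IsPrim f f') :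
    IntervalIntegrable f' volume 0 1 :=
  (intervalIntegrable_iff_integrableOn_Icc_of_le zero_le_one).2 hf.1

lemma IsPrim.ii {f f' : ℝ → E} (hf : IsPrim f f') {a b : ℝ} (ha : a ∈ Icc (0:ℝ) 1)
    (hb : b ∈ Icc (0:ℝ) 1) : IntervalIntegrable f' volume a b := by
  apply hf.intervalIntegrable.mono_set
  rw [uIcc_of_le zero_le_one]
  exact uIcc_subset_Icc ha hb

lemma IsPrim.ae_hasDerivAt [CompleteSpace E] {f f' : ℝ → E} (hf : IsPrim f f') :
    ∀ᵐ t ∂(volume.restrict (Ioo (0:ℝ) 1)), HasDerivAt f (f' t) t := by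
  rw [ae_restrict_iff' measurableSet_Ioo]
  filter_upwards [hf.intervalIntegrable.ae_hasDerivAt_integral] with t ht htI
  have h1 := ht (by rw [uIcc_of_le zero_le_one]; exact Ioo_subset_Icc_self htI) 0 (by simp)
  have h2 : HasDerivAt (fun t => f 0 + ∫ s in (0:ℝ)..t, f' s) (f' t) t := h1.const_add _
  apply h2.congr_of_eventuallyEq
  filter_upwards [Ioo_mem_nhds htI.1 htI.2] with s hs
  exact hf.2 s (Ioo_subset_Icc_self hs)

lemma IsPrim.congr {f g f' g' : ℝ → E} (hf : IsPrim f f') (h : ∀ t ∈ Icc (0:ℝ) 1, f t = g t)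
    (h' : ∀ᵐ t ∂(volume.restrict (Ioo (0:ℝ) 1)), f' t = g' t) : IsPrim g g' := by
  have h'' : f' =ᵐ[volume.restrict (Icc (0:ℝ) 1)] g' := by
    rw [restrict_Ioo_eq_restrict_Icc] at h'; exact h'
  refine ⟨hf.1.congr h'', fun t ht => ?_⟩
  rw [← h t ht, ← h 0 (by simp), hf.2 t ht]
  congr 1
  apply intervalIntegral.integral_congr_ae
  rw [EventuallyEq, ae_restrict_iff' measurableSet_Icc] at h''
  filter_upwards [h''] with s hs hst
  rw [uIoc_of_le ht.1] at hst
  exact hs ⟨hst.1.le, hst.2.trans ht.2⟩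

lemma IsPrim.continuousOn {f f' : ℝ → E} (hf : IsPrim f f') :
    ContinuousOn f (Icc (0:ℝ) 1) := by
  have : ContinuousOn (fun t => f 0 + ∫ s in (0:ℝ)..t, f' s) (Icc (0:ℝ) 1) :=
    continuousOn_const.add (intervalIntegral.continuousOn_primitive_interval
      (by rw [uIcc_of_le zero_le_one]; exact hf.1) |>.mono (by rw [uIcc_of_le zero_le_one]))
  exact this.congr hf.2

lemma ac_of_dist_le {X : Type*} [PseudoMetricSpace X] {F : ℝ → X} {G : ℝ → ℝ} {C a b : ℝ}
    (hG : AbsolutelyContinuousOnInterval G a b)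
    (h : ∀ s ∈ uIcc a b, ∀ t ∈ uIcc a b, dist (F s) (F t) ≤ C * dist (G s) (G t)) :
    AbsolutelyContinuousOnInterval F a b := by
  unfold AbsolutelyContinuousOnInterval at *
  have h2 := hG.const_mul C
  rw [mul_zero] at h2
  refine squeeze_zero' ?_ ?_ h2
  · exact Eventually.of_forall fun E => Finset.sum_nonneg (fun _ _ ↦ dist_nonneg)
  · have : ∀ᶠ E in (AbsolutelyContinuousOnInterval.totalLengthFilter ⊓
      𝓟 (AbsolutelyContinuousOnInterval.disjWithin a b)),
        E ∈ AbsolutelyContinuousOnInterval.disjWithin a b :=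
      mem_inf_of_right (mem_principal_self _)
    filter_upwards [this] with E hE
    rw [Finset.mul_sum]
    exact Finset.sum_le_sum fun i hi => h _ (hE.1 i hi).1 _ (hE.1 i hi).2

lemma IsPrim.dist_le {f f' : ℝ → E} (hf : IsPrim f f') {s t : ℝ} (hs : s ∈ Icc (0:ℝ) 1)
    (ht : t ∈ Icc (0:ℝ) 1) :
    dist (f s) (f t) ≤ dist (∫ x in (0:ℝ)..s, ‖f' x‖) (∫ x in (0:ℝ)..t, ‖f' x‖) := by
  have h0 : (0:ℝ) ∈ Icc (0:ℝ) 1 := by simp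
  rw [hf.2 s hs, hf.2 t ht, dist_add_left, dist_eq_norm, dist_eq_norm,
    intervalIntegral.integral_interval_sub_left (hf.ii h0 hs) (hf.ii h0 ht),
    intervalIntegral.integral_interval_sub_left (hf.ii h0 hs).norm (hf.ii h0 ht).norm]
  exact intervalIntegral.norm_integral_le_abs_integral_norm

/-- chain rule for absolutely continuous functions -/
lemma IsPrim.chain [CompleteSpace E] {f f' : ℝ → E} (hf : IsPrim f f') {Φ : E → ℝ}
    (hΦ : ∀ t ∈ Icc (0:ℝ) 1, ContDiffAt ℝ 1 Φ (f t)) :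
    IsPrim (fun t => Φ (f t)) (fun t => fderiv ℝ Φ (f t) (f' t)) := by
  have hcomp : IsCompact (f '' Icc (0:ℝ) 1) := isCompact_Icc.image_of_continuousOn hf.continuousOn
  have hll : LocallyLipschitzOn (f '' Icc (0:ℝ) 1) Φ := by
    rintro _ ⟨t, ht, rfl⟩
    obtain ⟨K, u, hu, hK⟩ := (hΦ t ht).exists_lipschitzOnWith
    exact ⟨K, u, mem_nhdsWithin_of_mem_nhds hu, hK⟩
  obtain ⟨K, hK⟩ := hll.exists_lipschitzOnWith_of_compact hcomp
  have hac : AbsolutelyContinuousOnInterval (fun t => Φ (f t)) 0 1 := by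
    refine ac_of_dist_le (C := K)
      (hf.intervalIntegrable.norm.absolutelyContinuousOnInterval_intervalIntegral
        (c := 0) (by simp)) ?_
    intro s hs t ht
    rw [uIcc_of_le zero_le_one] at hs ht
    calc dist (Φ (f s)) (Φ (f t)) ≤ K * dist (f s) (f t) :=
          hK.dist_le_mul _ (mem_image_of_mem _ hs) _ (mem_image_of_mem _ ht)
      _ ≤ _ := by gcongr; exact hf.dist_le hs ht
  have hd : ∀ᵐ t ∂(volume.restrict (Ioo (0:ℝ) 1)),
      deriv (fun t => Φ (f t)) t = fderiv ℝ Φ (f t) (f' t) := by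
    filter_upwards [hf.ae_hasDerivAt, ae_restrict_mem measurableSet_Ioo] with t ht htI
    have := (hΦ t (Ioo_subset_Icc_self htI)).differentiableAt one_ne_zero
    exact (this.hasFDerivAt.comp_hasDerivAt t ht).deriv
  have key : IsPrim (fun t => Φ (f t)) (deriv (fun t => Φ (f t))) := by
    refine ⟨(intervalIntegrable_iff_integrableOn_Icc_of_le zero_le_one).1
      hac.intervalIntegrable_deriv, fun t ht => ?_⟩
    have : AbsolutelyContinuousOnInterval (fun t => Φ (f t)) 0 t := hac.mono (by
      rw [uIcc_of_le zero_le_one]; exact uIcc_subset_Icc (by simp) ht)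
    rw [this.integral_deriv_eq_sub]; ring
  exact key.congr (fun _ _ => rfl) hd

lemma IsPrim.of_tendsto {f k : ℝ → ℝ} {F K : ℕ → ℝ → ℝ} {b : ℝ → ℝ}
    (h : ∀ n, IsPrim (F n) (K n)) (hF : ∀ t ∈ Icc (0:ℝ) 1, Tendsto (fun n => F n t) atTop (𝓝 (f t)))
    (hK : ∀ᵐ t ∂(volume.restrict (Ioo (0:ℝ) 1)), Tendsto (fun n => K n t) atTop (𝓝 (k t)))
    (hb : IntegrableOn b (Icc (0:ℝ) 1))
    (hKb : ∀ n, ∀ᵐ t ∂(volume.restrict (Ioo (0:ℝ) 1)), ‖K n t‖ ≤ b t) : IsPrim f k := by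
  rw [restrict_Ioo_eq_restrict_Icc] at hK
  simp only [restrict_Ioo_eq_restrict_Icc] at hKb
  constructor
  · refine Integrable.mono' hb (aestronglyMeasurable_of_tendsto_ae atTop
      (fun n => (h n).1.aestronglyMeasurable) hK) ?_
    filter_upwards [hK, ae_all_iff.2 hKb] with t h1 h2
    exact le_of_tendsto h1.norm (Eventually.of_forall h2)
  · intro t ht
    have hle : volume.restrict (Ioc 0 t) ≤ volume.restrict (Icc (0:ℝ) 1) :=
      Measure.restrict_mono (s := Ioc 0 t) (s' := Icc (0:ℝ) 1)
        (fun x hx => ⟨hx.1.le, hx.2.trans ht.2⟩) le_rfl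
    have h1 : Tendsto (fun n => ∫ s in (0:ℝ)..t, K n s) atTop (𝓝 (∫ s in (0:ℝ)..t, k s)) := by
      simp only [intervalIntegral.integral_of_le ht.1]
      refine tendsto_integral_of_dominated_convergence b
        (fun n => (h n).1.aestronglyMeasurable.mono_measure hle) (Integrable.mono_measure hb hle)
        (fun n => ae_mono hle (hKb n)) (ae_mono hle hK)
    have h2 : Tendsto (fun n => F n t) atTop (𝓝 (f 0 + ∫ s in (0:ℝ)..t, k s)) := by
      simp only [fun n => (h n).2 t ht]
      exact (hF 0 (by simp)).add h1
    exact tendsto_nhds_unique (hF t ht) h2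

lemma IsPrim.of_inner {d : ℕ} {f f' : ℝ → Euc d} (hi : IntegrableOn f' (Icc (0:ℝ) 1))
    (h : ∀ b : Euc d, IsPrim (fun t => inner ℝ b (f t)) (fun t => inner ℝ b (f' t))) :
    IsPrim f f' := by
  refine ⟨hi, fun t ht => ?_⟩
  refine ext_inner_left ℝ fun b => ?_
  have h1 := (h b).2 t ht
  simp only at h1
  rw [h1, inner_add_right]
  congr 1
  simp only [intervalIntegral.integral_of_le ht.1]
  exact integral_inner (hi.mono_set (s := Ioc 0 t)
    (fun x hx => ⟨hx.1.le, hx.2.trans ht.2⟩)) b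

end OneD

lemma IsPrim.chain2 {E : Type*} [NormedAddCommGroup E] [NormedSpace ℝ E] [CompleteSpace E]
    {f f' : ℝ → E} (hf : IsPrim f f') {Φ : E → ℝ} {k : ℝ → ℝ}
    (hΦ : ∀ t ∈ Icc (0:ℝ) 1, ContDiffAt ℝ 1 Φ (f t))
    (hk : ∀ᵐ t ∂(volume.restrict (Ioo (0:ℝ) 1)), HasDerivAt (fun t => Φ (f t)) (k t) t) :
    IsPrim (fun t => Φ (f t)) k := by
  refine (hf.chain hΦ).congr (fun _ _ => rfl) ?_
  filter_upwards [hk, (hf.chain hΦ).ae_hasDerivAt] with t h1 h2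
  exact h2.unique h1

lemma IsPrim.prodMk {E F : Type*} [NormedAddCommGroup E] [NormedSpace ℝ E] [CompleteSpace E]
    [NormedAddCommGroup F] [NormedSpace ℝ F] [CompleteSpace F] {f f' : ℝ → E} {g g' : ℝ → F}
    (hf : IsPrim f f') (hg : IsPrim g g') :
    IsPrim (fun t => (f t, g t)) (fun t => (f' t, g' t)) := by
  refine ⟨hf.1.prodMk hg.1, fun t ht => ?_⟩
  have hh : ∫ s in (0:ℝ)..t, (f' s, g' s)
      = (∫ s in (0:ℝ)..t, f' s, ∫ s in (0:ℝ)..t, g' s) :=  by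
    simp only [intervalIntegral.integral_of_le ht.1]
    have hs : Ioc 0 t ⊆ Icc (0:ℝ) 1 := (fun x hx => ⟨hx.1.le, hx.2.trans ht.2⟩)
    exact integral_pair (hf.1.mono_set hs) (hg.1.mono_set hs)
  rw [hh, Prod.mk_add_mk, ← hf.2 t ht, ← hg.2 t ht]

/-- smooth test functions on `(0,1)` -/
def IsTest1 (ψ : ℝ → ℝ) : Prop :=
  ContDiff ℝ (⊤ : ℕ∞) ψ ∧ HasCompactSupport ψ ∧ tsupport ψ ⊆ Ioo (0:ℝ) 1

lemma IsTest1.zero_off {ψ : ℝ → ℝ} (hψ : IsTest1 ψ) {t : ℝ} (ht : t ∉ Ioo (0:ℝ) 1) : ψ t = 0 :=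
  image_eq_zero_of_notMem_tsupport fun h => ht (hψ.2.2 h)

lemma compact_sub_Icc {K : Set ℝ} (hK : IsCompact K) (h : K ⊆ Ioo (0:ℝ) 1) :
    ∃ a b : ℝ, 0 < a ∧ a ≤ b ∧ b < 1 ∧ K ⊆ Icc a b := by
  rcases K.eq_empty_or_nonempty with rfl | hne
  · exact ⟨1/2, 1/2, by norm_num, le_rfl, by norm_num, by simp⟩
  · refine ⟨sInf K, sSup K, (h (hK.sInf_mem hne)).1, ?_, (h (hK.sSup_mem hne)).2, ?_⟩
    · exact (csInf_le hK.bddBelow hne.some_mem).trans (le_csSup hK.bddAbove hne.some_mem)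
    · exact subset_Icc_csInf_csSup hK.bddBelow hK.bddAbove

/-- a smooth compactly supported function of mean zero has a compactly supported primitive -/
lemma exists_test_primitive {θ : ℝ → ℝ} (hθ : IsTest1 θ) (h0 : ∫ s in (0:ℝ)..1, θ s = 0) :
    ∃ ψ, IsTest1 ψ ∧ deriv ψ = θ := by
  obtain ⟨a, b, ha, hab, hb, hsub⟩ := compact_sub_Icc hθ.2.1 hθ.2.2
  have hcont : Continuous θ := hθ.1.continuous
  have hz : ∀ t, t ∉ Icc a b → θ t = 0 := fun t ht =>
    image_eq_zero_of_notMem_tsupport fun h => ht (hsub h)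
  have hd : ∀ t, HasDerivAt (fun t => ∫ s in (0:ℝ)..t, θ s) (θ t) t := fun t =>
    intervalIntegral.integral_hasDerivAt_right (hcont.intervalIntegrable _ _)
      hcont.aestronglyMeasurable.stronglyMeasurableAtFilter hcont.continuousAt
  have hderiv : deriv (fun t => ∫ s in (0:ℝ)..t, θ s) = θ := funext fun t => (hd t).deriv
  have hsupp : Function.support (fun t => ∫ s in (0:ℝ)..t, θ s) ⊆ Icc a b := by
    intro t ht
    by_contra hn
    apply ht
    simp only
    rw [mem_Icc, not_and_or, not_le, not_le] at hn
    rcases hn with hn | hn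
    · apply intervalIntegral.integral_zero_ae
      refine Eventually.of_forall fun s hs => hz s fun h => ?_
      rcases le_total 0 t with h' | h'
      · rw [uIoc_of_le h'] at hs; linarith [hs.2, h.1]
      · rw [uIoc_of_ge h'] at hs; linarith [hs.2, h.1]
    · have : ∫ s in (t:ℝ)..1, θ s = 0 := by
        apply intervalIntegral.integral_zero_ae
        refine Eventually.of_forall fun s hs => hz s fun h => ?_
        rcases le_total t 1 with h' | h'
        · rw [uIoc_of_le h'] at hs; linarith [hs.1, h.2]
        · rw [uIoc_of_ge h'] at hs; linarith [hs.1, h.2]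
      rw [← intervalIntegral.integral_add_adjacent_intervals (b := t)
        (hcont.intervalIntegrable _ _) (hcont.intervalIntegrable _ _), this, add_zero] at h0
      exact h0
  have hts : tsupport (fun t => ∫ s in (0:ℝ)..t, θ s) ⊆ Icc a b :=
    closure_minimal hsupp isClosed_Icc
  refine ⟨fun t => ∫ s in (0:ℝ)..t, θ s, ⟨?_, ?_, ?_⟩, hderiv⟩
  · rw [contDiff_infty_iff_deriv, hderiv]
    exact ⟨fun t => (hd t).differentiableAt, hθ.1⟩
  · exact HasCompactSupport.of_support_subset_isCompact isCompact_Icc hsupp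
  · exact hts.trans fun t ht => ⟨ha.trans_le ht.1, ht.2.trans_lt hb⟩

/-- the du Bois-Reymond lemma, part one -/
lemma const_of_test {F : ℝ → ℝ} (hF : ContinuousOn F (Icc (0:ℝ) 1))
    (h : ∀ ψ, IsTest1 ψ → ∫ t in (0:ℝ)..1, deriv ψ t * F t = 0) :
    ∀ t ∈ Icc (0:ℝ) 1, F t = F 0 := by
  obtain ⟨ζ, hζ, hζ1⟩ : ∃ ζ, IsTest1 ζ ∧ ∫ t in (0:ℝ)..1, ζ t = 1 := by
    let B : ContDiffBump (1/2 : ℝ) := ⟨1/8, 1/4, by norm_num, by norm_num⟩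
    have hts : tsupport (B.normed volume) ⊆ Ioo (0:ℝ) 1 := by
      rw [B.tsupport_normed_eq, Real.closedBall_eq_Icc]
      intro t ht
      simp only [B, mem_Icc] at ht
      exact ⟨by linarith [ht.1], by linarith [ht.2]⟩
    refine ⟨B.normed volume, ⟨B.contDiff_normed, B.hasCompactSupport_normed, hts⟩, ?_⟩
    refine Eq.trans ?_ (B.integral_normed (μ := volume))
    rw [intervalIntegral.integral_of_le zero_le_one]
    apply setIntegral_eq_integral_of_forall_compl_eq_zero
    intro t ht
    apply image_eq_zero_of_notMem_tsupport fun h => ht ?_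
    exact Ioo_subset_Ioc_self (hts h)
  have hFi : IntervalIntegrable F volume 0 1 :=
    ContinuousOn.intervalIntegrable (by rwa [uIcc_of_le zero_le_one])
  set c := ∫ t in (0:ℝ)..1, ζ t * F t with hc
  have key : ∀ ξ, IsTest1 ξ → ∫ t in (0:ℝ)..1, ξ t * (F t - c) = 0 := by
    intro ξ hξ
    set e := ∫ t in (0:ℝ)..1, ξ t with he
    have hξi : IntervalIntegrable ξ volume 0 1 := hξ.1.continuous.intervalIntegrable _ _
    have hζi : IntervalIntegrable ζ volume 0 1 := hζ.1.continuous.intervalIntegrable _ _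
    have ht : IsTest1 (fun t => ξ t - e * ζ t) := by
      refine ⟨hξ.1.sub (contDiff_const.mul hζ.1), ?_, ?_⟩
      · exact hξ.2.1.sub (hζ.2.1.mul_left)
      · refine (tsupport_sub _ _).trans (union_subset hξ.2.2 ?_)
        exact (tsupport_mul_subset_right).trans hζ.2.2
    obtain ⟨ψ, hψ, hd⟩ := exists_test_primitive ht (by
      rw [intervalIntegral.integral_sub hξi (hζi.const_mul _),
        intervalIntegral.integral_const_mul, hζ1, ← he]; ring)
    have h2 := h ψ hψ
    rw [hd] at h2
    have i1 : IntervalIntegrable (fun t => ξ t * F t) volume 0 1 :=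
      hFi.continuousOn_mul hξ.1.continuous.continuousOn
    have i2 : IntervalIntegrable (fun t => ζ t * F t) volume 0 1 :=
      hFi.continuousOn_mul hζ.1.continuous.continuousOn
    have h3 : ∫ t in (0:ℝ)..1, (ξ t * F t - e * (ζ t * F t)) = 0 := by
      rw [← h2]; congr 1; ext t; ring
    rw [intervalIntegral.integral_sub i1 (i2.const_mul _),
        intervalIntegral.integral_const_mul, ← hc] at h3
    have h4 : ∫ t in (0:ℝ)..1, ξ t * (F t - c) = ∫ t in (0:ℝ)..1, (ξ t * F t - ξ t * c) := by
      congr 1; ext t; ring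
    rw [h4, intervalIntegral.integral_sub i1 (hξi.mul_const _),
      intervalIntegral.integral_mul_const, ← he]
    linarith
  have hae := isOpen_Ioo.ae_eq_zero_of_integral_contDiff_smul_eq_zero (U := Ioo (0:ℝ) 1)
    (μ := volume) (f := fun t => F t - c)
    (((hF.sub continuousOn_const).mono Ioo_subset_Icc_self).locallyIntegrableOn
      measurableSet_Ioo) (by
      intro g hg1 hg2 hg3
      rw [← key g ⟨hg1, hg2, hg3⟩, intervalIntegral.integral_of_le zero_le_one]
      symm
      apply setIntegral_eq_integral_of_forall_compl_eq_zero
      intro t ht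
      rw [image_eq_zero_of_notMem_tsupport fun h => ht (Ioo_subset_Ioc_self (hg3 h)), zero_mul])
  have heq : EqOn F (fun _ => c) (Icc (0:ℝ) 1) := by
    refine Measure.eqOn_Icc_of_ae_eq volume zero_ne_one ?_ hF continuousOn_const
    rw [← restrict_Ioo_eq_restrict_Icc, EventuallyEq, ae_restrict_iff' measurableSet_Ioo]
    filter_upwards [hae] with t h1 h2
    linarith [h1 h2]
  intro t ht
  rw [heq ht, heq (by simp : (0:ℝ) ∈ Icc (0:ℝ) 1)]

lemma integral_test_mul {ψ K k : ℝ → ℝ} (hψ : IsTest1 ψ) (hK : IsPrim K k) :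
    ∫ t in (0:ℝ)..1, (deriv ψ t * K t + ψ t * k t) = 0 := by
  have hψd : ∀ t, HasDerivAt ψ (deriv ψ t) t := fun t =>
    (hψ.1.differentiable (by simp)).differentiableAt.hasDerivAt
  have hψc : Continuous (deriv ψ) := hψ.1.continuous_deriv (by simp)
  have hp : IsPrim ψ (deriv ψ) := by
    refine ⟨hψc.integrableOn_Icc, fun t ht => ?_⟩
    rw [intervalIntegral.integral_eq_sub_of_hasDerivAt (fun s _ => hψd s)
      (hψc.intervalIntegrable _ _)]; ring
  have hpair := hp.prodMk hK
  have hch := hpair.chain2 (Φ := fun x : ℝ × ℝ => x.1 * x.2)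
    (k := fun t => deriv ψ t * K t + ψ t * k t)
    (fun t _ => (contDiff_fst.mul contDiff_snd).contDiffAt)
    (by filter_upwards [hK.ae_hasDerivAt] with t ht using (hψd t).mul ht)
  have h1 := hch.2 1 (by simp)
  simp only [hψ.zero_off (t := 0) (by simp), hψ.zero_off (t := 1) (by simp), zero_mul,
    zero_add] at h1
  exact h1.symm

lemma du_bois_reymond {f k : ℝ → ℝ} (hf : ContinuousOn f (Icc (0:ℝ) 1))
    (hk : IntegrableOn k (Icc (0:ℝ) 1))
    (h : ∀ ψ, IsTest1 ψ → ∫ t in (0:ℝ)..1, (deriv ψ t * f t + ψ t * k t) = 0) : IsPrim f k := by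
  have hK : IsPrim (fun t => ∫ s in (0:ℝ)..t, k s) k := ⟨hk, fun t ht => by simp⟩
  have hc := const_of_test (F := fun t => f t - ∫ s in (0:ℝ)..t, k s) (hf.sub hK.continuousOn) (by
    intro ψ hψ
    have e1 := h ψ hψ
    have e2 := integral_test_mul hψ hK
    have hψc : Continuous (deriv ψ) := hψ.1.continuous_deriv (by simp)
    have i3 : IntervalIntegrable (fun t => ψ t * k t) volume 0 1 :=
      hK.intervalIntegrable.continuousOn_mul hψ.1.continuous.continuousOn
    have i1 : IntervalIntegrable (fun t => deriv ψ t * f t) volume 0 1 :=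
      ContinuousOn.intervalIntegrable (by
        rw [uIcc_of_le zero_le_one]; exact hψc.continuousOn.mul hf)
    have i2 : IntervalIntegrable (fun t => deriv ψ t * ∫ s in (0:ℝ)..t, k s) volume 0 1 :=
      ContinuousOn.intervalIntegrable (by
        rw [uIcc_of_le zero_le_one]; exact hψc.continuousOn.mul hK.continuousOn)
    have := intervalIntegral.integral_sub (i1.add i3) (i2.add i3)
    rw [e1, e2, sub_zero] at this
    refine Eq.trans ?_ this
    congr 1; ext t; ring)
  refine ⟨hk, fun t ht => ?_⟩
  have := hc t ht
  simp at this
  linarith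

lemma div_sqrt_bound {h ε : ℝ} (hh : 0 ≤ h) (hε : 0 < ε) : h / √(h + ε) ≤ √h := by
  rw [div_le_iff₀ (Real.sqrt_pos.2 (by linarith))]
  calc h = √h * √h := (Real.mul_self_sqrt hh).symm
    _ ≤ √h * √(h + ε) := by gcongr; linarith

lemma sqrt_lemma {h y G W : ℝ → ℝ} {C : ℝ} (hh : ∀ t ∈ Icc (0:ℝ) 1, 0 ≤ h t)
    (hC : 0 ≤ C) (hy : ∀ t ∈ Icc (0:ℝ) 1, |y t| ≤ C * h t)
    (hP : IsPrim h (fun t => G t * h t)) (hyP : IsPrim y (fun t => h t * W t + G t * y t))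
    (hW : IntegrableOn (fun t => √(h t) * |W t|) (Icc (0:ℝ) 1))
    (hG : IntegrableOn (fun t => √(h t) * |G t|) (Icc (0:ℝ) 1)) :
    IsPrim (fun t => y t / √(h t)) (fun t => √(h t) * W t + G t * y t / (2 * √(h t))) := by
  set ε : ℕ → ℝ := fun n => 1 / ((n:ℝ) + 1) with hε
  have hεp : ∀ n, 0 < ε n := fun n => by simp only [hε]; positivity
  have hε0 : Tendsto ε atTop (𝓝 0) := tendsto_one_div_add_atTop_nhds_zero_nat
  have hsq : ∀ t, Tendsto (fun n => √(h t + ε n)) atTop (𝓝 √(h t)) := by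
    intro t
    have : Tendsto (fun n => h t + ε n) atTop (𝓝 (h t + 0)) := tendsto_const_nhds.add hε0
    rw [add_zero] at this
    exact (Real.continuous_sqrt.tendsto _).comp this
  refine IsPrim.of_tendsto (F := fun n t => y t / √(h t + ε n))
    (K := fun n t => (h t * W t + G t * y t) / √(h t + ε n)
      - y t * (G t * h t) / (2 * √(h t + ε n) ^ 3))
    (b := fun t => √(h t) * |W t| + C * (√(h t) * |G t|) + C / 2 * (√(h t) * |G t|)) ?_ ?_ ?_ ?_ ?_
  · intro n
    refine (hP.prodMk hyP).chain2 (Φ := fun x : ℝ × ℝ => x.2 / √(x.1 + ε n)) ?_ ?_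
    · intro t ht
      have hp : h t + ε n ≠ 0 := by have := hh t ht; have := hεp n; positivity
      refine ContDiffAt.div contDiffAt_snd ?_ ?_
      · exact ContDiffAt.sqrt (contDiffAt_fst.add contDiffAt_const) hp
      · have := hh t ht; have := hεp n
        simp only
        positivity
    · filter_upwards [hP.ae_hasDerivAt, hyP.ae_hasDerivAt, ae_restrict_mem measurableSet_Ioo]
        with t h1 h2 htI
      have hp0 : 0 < h t + ε n := by
        have := hh t (Ioo_subset_Icc_self htI); have := hεp n; positivity
      have hs := Real.sqrt_pos.2 hp0
      have h3 : HasDerivAt (fun t => √(h t + ε n)) (G t * h t / (2 * √(h t + ε n))) t :=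
        (h1.add_const (ε n)).sqrt hp0.ne'
      refine (h2.div h3 hs.ne').congr_deriv ?_
      field_simp
  · intro t ht
    rcases (hh t ht).eq_or_lt with h0 | h0
    · have : y t = 0 := by have := hy t ht; rw [← h0, mul_zero] at this; simpa using this
      simp [this]
    · exact tendsto_const_nhds.div (hsq t) (Real.sqrt_pos.2 h0).ne'
  · filter_upwards [ae_restrict_mem measurableSet_Ioo] with t htI
    have ht := Ioo_subset_Icc_self htI
    rcases (hh t ht).eq_or_lt with h0 | h0
    · have : y t = 0 := by have := hy t ht; rw [← h0, mul_zero] at this; simpa using this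
      simp [this, ← h0]
    · have hs := Real.sqrt_pos.2 h0
      have e : √(h t) * W t + G t * y t / (2 * √(h t)) = (h t * W t + G t * y t) / √(h t)
          - y t * (G t * h t) / (2 * √(h t) ^ 3) := by
        have hq : h t = √(h t) ^ 2 := (Real.sq_sqrt h0.le).symm
        generalize √(h t) = r at *
        rw [hq]
        field_simp
        ring
      rw [e]
      exact (tendsto_const_nhds.div (hsq t) hs.ne').sub
        (tendsto_const_nhds.div (((hsq t).pow 3).const_mul 2) (by positivity))
  · exact (hW.add (hG.const_mul C)).add (hG.const_mul (C/2))
  · intro n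
    filter_upwards [ae_restrict_mem measurableSet_Ioo] with t htI
    have ht := Ioo_subset_Icc_self htI
    have h0 := hh t ht
    have hp0 : 0 < h t + ε n := by have := hεp n; positivity
    have hs := Real.sqrt_pos.2 hp0
    have hb := div_sqrt_bound h0 (hεp n)
    have hyt := hy t ht
    have hr : h t ≤ √(h t + ε n) ^ 2 := by rw [Real.sq_sqrt hp0.le]; linarith [hεp n]
    have hb2 : h t * h t / √(h t + ε n) ^ 3 ≤ √(h t) := by
      refine le_trans ?_ hb
      rw [div_le_div_iff₀ (by positivity) hs]
      have : h t * h t * √(h t + ε n) ≤ h t * (√(h t + ε n) ^ 2) * √(h t + ε n) := by gcongr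
      linarith
    set r := √(h t + ε n)
    have t1 : |h t * W t / r| ≤ √(h t) * |W t| := by
      rw [abs_div, abs_mul, abs_of_nonneg h0, abs_of_pos hs, mul_div_right_comm]
      gcongr
    have t2 : |G t * y t / r| ≤ C * (√(h t) * |G t|) := by
      rw [abs_div, abs_mul, abs_of_pos hs]
      calc |G t| * |y t| / r ≤ |G t| * (C * h t) / r := by gcongr
        _ = C * (h t / r * |G t|) := by ring
        _ ≤ _ := by gcongr
    have t3 : |y t * (G t * h t) / (2 * r ^ 3)| ≤ C / 2 * (√(h t) * |G t|) := by
      rw [abs_div, abs_mul, abs_mul, abs_of_nonneg h0, abs_of_pos (by positivity : 0 < 2 * r ^ 3)]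
      calc |y t| * (|G t| * h t) / (2 * r ^ 3) ≤ (C * h t) * (|G t| * h t) / (2 * r ^ 3) := by gcongr
        _ = C / 2 * (h t * h t / r ^ 3 * |G t|) := by ring
        _ ≤ _ := by gcongr
    rw [Real.norm_eq_abs, add_div]
    calc _ ≤ |h t * W t / r + G t * y t / r| + |y t * (G t * h t) / (2 * r ^ 3)| := abs_sub _ _
      _ ≤ |h t * W t / r| + |G t * y t / r| + |y t * (G t * h t) / (2 * r ^ 3)| := by
        gcongr; exact abs_add_le _ _
      _ ≤ _ := by gcongr

lemma isPrim_id : IsPrim (fun t : ℝ => t) (fun _ => (1:ℝ)) :=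
  ⟨by simp, fun t _ => by simp⟩

lemma IsTest.bounds {φ : XX d → ℝ} (hφ : IsTest φ) :
    ∃ M : ℝ, 0 ≤ M ∧ (∀ x, |φ x| ≤ M) ∧ ∀ x, ‖fderiv ℝ φ x‖ ≤ M := by
  obtain ⟨M1, h1⟩ := hφ.2.1.exists_bound_of_continuous hφ.1.continuous
  obtain ⟨M2, h2⟩ := (hφ.2.1.fderiv ℝ).exists_bound_of_continuous
    (hφ.1.continuous_fderiv (by simp))
  refine ⟨max M1 M2, ?_, fun x => (h1 x).trans (le_max_left _ _),
    fun x => (h2 x).trans (le_max_right _ _)⟩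
  exact ((norm_nonneg _).trans (h1 0)).trans (le_max_left _ _)

lemma IsTest.zero_off {φ : XX d → ℝ} (hφ : IsTest φ) {x : XX d} (hx : x.1 ∉ Ioo (0:ℝ) 1) :
    φ x = 0 :=
  image_eq_zero_of_notMem_tsupport fun h => hx (hφ.2.2 h).1

lemma ce_1d {φ : XX d → ℝ} (hφ : IsTest φ) {p p' : ℝ → ℝ} {q q' : ℝ → Euc d}
    (hp : IsPrim p p') (hq : IsPrim q q') (hp0 : ∀ t ∈ Icc (0:ℝ) 1, 0 ≤ p t)
    (hqz : ∀ t ∈ Icc (0:ℝ) 1, p t = 0 → q t = 0) :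
    ∫ t in (0:ℝ)..1, (p t ^ 2 * fderiv ℝ φ (t, (p t)⁻¹ • q t) ((1:ℝ), (0 : Euc d))
      + fderiv ℝ φ (t, (p t)⁻¹ • q t) ((0:ℝ), p t • q' t - p' t • q t)
      + φ (t, (p t)⁻¹ • q t) * (2 * p t * p' t)) = 0 := by
  obtain ⟨M, hM0, hM1, hM2⟩ := hφ.bounds
  set ε : ℕ → ℝ := fun n => 1 / ((n:ℝ) + 1) with hε
  have hεp : ∀ n, 0 < ε n := fun n => by simp only [hε]; positivity
  have hε0 : Tendsto ε atTop (𝓝 0) := tendsto_one_div_add_atTop_nhds_zero_nat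
  set c : ℕ → ℝ → Euc d := fun n t => (p t / (p t ^ 2 + ε n)) • q t with hc
  set c' : ℕ → ℝ → Euc d := fun n t => (p t / (p t ^ 2 + ε n)) • q' t +
    ((p' t * (p t ^ 2 + ε n) - p t * (2 * p t * p' t)) / (p t ^ 2 + ε n) ^ 2) • q t with hc'
  have hsm : ∀ t, Tendsto (fun n => p t ^ 2 + ε n) atTop (𝓝 (p t ^ 2)) := by
    intro t
    have : Tendsto (fun n => p t ^ 2 + ε n) atTop (𝓝 (p t ^ 2 + 0)) := tendsto_const_nhds.add hε0
    rwa [add_zero] at this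
  have hcl : ∀ t, Tendsto (fun n => (t, c n t)) atTop (𝓝 ((t, (p t)⁻¹ • q t) : XX d)) := by
    intro t
    refine tendsto_const_nhds.prodMk_nhds ?_
    by_cases h0 : p t = 0
    · simp [hc, h0]
    · refine Tendsto.smul_const ?_ _
      have : (p t)⁻¹ = p t / (p t ^ 2) := by field_simp
      rw [this]
      exact tendsto_const_nhds.div (hsm t) (by positivity)
  have hmain := IsPrim.of_tendsto
    (F := fun n t => p t ^ 2 * φ (t, c n t))
    (K := fun n t => 2 * p t * p' t * φ (t, c n t)
      + p t ^ 2 * fderiv ℝ φ (t, c n t) ((1:ℝ), c' n t))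
    (f := fun t => p t ^ 2 * φ (t, (p t)⁻¹ • q t))
    (k := fun t => (p t ^ 2 * fderiv ℝ φ (t, (p t)⁻¹ • q t) ((1:ℝ), (0 : Euc d))
      + fderiv ℝ φ (t, (p t)⁻¹ • q t) ((0:ℝ), p t • q' t - p' t • q t)
      + φ (t, (p t)⁻¹ • q t) * (2 * p t * p' t)))
    (b := fun t => 2 * M * ‖p t * p' t‖ + M * (p t ^ 2 + ‖p t • q' t‖ + ‖p' t • q t‖)) ?_ ?_ ?_ ?_ ?_
  · have h1 := hmain.2 1 (by simp)
    simp only [hφ.zero_off (x := (1, (p 1)⁻¹ • q 1)) (by simp),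
      hφ.zero_off (x := (0, (p 0)⁻¹ • q 0)) (by simp), mul_zero, zero_add] at h1
    exact h1.symm
  · intro n
    refine (isPrim_id.prodMk (hp.prodMk hq)).chain2
      (Φ := fun x : ℝ × ℝ × Euc d => x.2.1 ^ 2 * φ (x.1, (x.2.1 / (x.2.1 ^ 2 + ε n)) • x.2.2)) ?_ ?_
    · intro t _
      have hφ1 : ContDiff ℝ 1 φ := hφ.1.of_le (by exact_mod_cast le_top)
      apply ContDiff.contDiffAt
      have h1 : ContDiff ℝ 1 (fun x : ℝ × ℝ × Euc d => x.2.1) := contDiff_fst.comp contDiff_snd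
      have h2 : ContDiff ℝ 1 (fun x : ℝ × ℝ × Euc d => x.2.2) := contDiff_snd.comp contDiff_snd
      refine (h1.pow 2).mul (hφ1.comp (contDiff_fst.prodMk ((h1.div ((h1.pow 2).add
        contDiff_const) ?_).smul h2)))
      intro x
      have := hεp n
      positivity
    · filter_upwards [hp.ae_hasDerivAt, hq.ae_hasDerivAt] with t h1 h2
      have hpos : p t ^ 2 + ε n ≠ 0 := by have := hεp n; positivity
      have h3 : HasDerivAt (fun t => p t ^ 2) (2 * p t * p' t) t := by
        simpa using h1.fun_pow 2
      have h4 : HasDerivAt (c n) (c' n t) t := (h1.div (h3.add_const (ε n)) hpos).smul h2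
      have h5 : HasDerivAt (fun t => φ (t, c n t)) (fderiv ℝ φ (t, c n t) (1, c' n t)) t :=
        ((hφ.1.differentiable (by simp)).differentiableAt.hasFDerivAt).comp_hasDerivAt t
          ((hasDerivAt_id t).prodMk h4)
      exact h3.mul h5
  · intro t _
    exact ((hφ.1.continuous.tendsto _).comp (hcl t)).const_mul _
  · filter_upwards [ae_restrict_mem measurableSet_Ioo] with t htI
    have ht := Ioo_subset_Icc_self htI
    by_cases h0 : p t = 0
    · simp only [h0, hqz t ht h0]
      simp
      exact (map_zero (fderiv ℝ φ (t, (0 : Euc d)))).symm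
    · have hφl : Tendsto (fun n => φ (t, c n t)) atTop (𝓝 (φ (t, (p t)⁻¹ • q t))) :=
        (hφ.1.continuous.tendsto _).comp (hcl t)
      have hdl : Tendsto (fun n => fderiv ℝ φ (t, c n t)) atTop
          (𝓝 (fderiv ℝ φ (t, (p t)⁻¹ • q t))) :=
        ((hφ.1.continuous_fderiv (by simp)).tendsto _).comp (hcl t)
      have hp2 : p t ^ 2 ≠ 0 := by positivity
      have hc'l : Tendsto (fun n => c' n t) atTop (𝓝 ((p t / (p t ^ 2)) • q' t +
          ((p' t * (p t ^ 2) - p t * (2 * p t * p' t)) / (p t ^ 2) ^ 2) • q t)) := by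
        refine ((tendsto_const_nhds.div (hsm t) hp2).smul_const _).add (Tendsto.smul_const ?_ _)
        exact (((hsm t).const_mul _).sub tendsto_const_nhds).div ((hsm t).pow 2) (by positivity)
      have h1 := ((((isBoundedBilinearMap_apply (𝕜 := ℝ) (E := XX d) (F := ℝ)).continuous.tendsto
        _).comp (hdl.prodMk_nhds
          (tendsto_const_nhds (x := (1:ℝ)).prodMk_nhds hc'l)))).const_mul (p t ^ 2)
      simp only [Function.comp_def] at h1
      have h2 := (hφl.const_mul (2 * p t * p' t)).add h1
      convert h2 using 2
      have e1 : ((1:ℝ), (p t / (p t ^ 2)) • q' t +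
          ((p' t * (p t ^ 2) - p t * (2 * p t * p' t)) / (p t ^ 2) ^ 2) • q t)
          = ((1:ℝ), (0 : Euc d)) + (p t ^ 2)⁻¹ • ((0:ℝ), p t • q' t - p' t • q t) := by
        ext1
        · simp
        · simp only [Prod.snd_add, Prod.smul_snd, zero_add, smul_sub, smul_smul]
          rw [sub_eq_add_neg (((p t ^ 2)⁻¹ * p t) • q' t), ← neg_smul]
          congr 2 <;> field_simp
          ring
      rw [e1, map_add, map_smul, smul_eq_mul]
      field_simp
      ring
  · have hpc := hp.continuousOn
    have hqc := hq.continuousOn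
    have i1 : IntegrableOn (fun t => p t * p' t) (Icc (0:ℝ) 1) :=
      hp.1.continuousOn_mul hpc isCompact_Icc
    have i2 : IntegrableOn (fun t => p t • q' t) (Icc (0:ℝ) 1) :=
      hq.1.continuousOn_smul hpc isCompact_Icc
    have i3 : IntegrableOn (fun t => p' t • q t) (Icc (0:ℝ) 1) :=
      hp.1.smul_continuousOn hqc isCompact_Icc
    have i4 : IntegrableOn (fun t => p t ^ 2) (Icc (0:ℝ) 1) :=
      (hpc.pow 2).integrableOn_compact isCompact_Icc
    exact (i1.norm.const_mul _).add (((i4.add i2.norm).add i3.norm).const_mul M)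
  · intro n
    filter_upwards [ae_restrict_mem measurableSet_Ioo] with t htI
    have ht := Ioo_subset_Icc_self htI
    have hpt := hp0 t ht
    have hεn := hεp n
    have hpos : 0 < p t ^ 2 + ε n := by positivity
    have hcb : p t ^ 2 * ‖c' n t‖ ≤ ‖p t • q' t‖ + ‖p' t • q t‖ := by
      have e : p t ^ 2 * ‖c' n t‖ = ‖p t ^ 2 • c' n t‖ := by
        rw [norm_smul, Real.norm_of_nonneg (by positivity)]
      rw [e]
      have e2 : p t ^ 2 • c' n t = (p t ^ 2 / (p t ^ 2 + ε n)) • (p t • q' t) +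
          (p t ^ 2 * (ε n - p t ^ 2) / (p t ^ 2 + ε n) ^ 2) • (p' t • q t) := by
        simp only [hc', smul_add, smul_smul]
        congr 2 <;> field_simp
        ring
      rw [e2]
      refine (norm_add_le _ _).trans (add_le_add ?_ ?_)
      · rw [norm_smul]
        refine mul_le_of_le_one_left (norm_nonneg _) ?_
        rw [Real.norm_of_nonneg (by positivity), div_le_one hpos]; linarith
      · rw [norm_smul]
        refine mul_le_of_le_one_left (norm_nonneg _) ?_
        rw [Real.norm_eq_abs, abs_div, abs_of_pos (pow_pos hpos 2), div_le_one (pow_pos hpos 2),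
          abs_le]
        constructor <;> nlinarith [sq_nonneg (p t), mul_nonneg (sq_nonneg (p t)) hεn.le,
          sq_nonneg (p t ^2), sq_nonneg (ε n)]
    have hdb : |fderiv ℝ φ (t, c n t) ((1:ℝ), c' n t)| ≤ M * (1 + ‖c' n t‖) := by
      refine ((fderiv ℝ φ (t, c n t)).le_opNorm _).trans ?_
      refine mul_le_mul (hM2 _) ?_ (norm_nonneg _) hM0
      rw [Prod.norm_def]
      exact max_le (by simp) (by simp)
    rw [Real.norm_eq_abs]
    calc _ ≤ |2 * p t * p' t * φ (t, c n t)| + |p t ^ 2 * fderiv ℝ φ (t, c n t) ((1:ℝ), c' n t)| :=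
          abs_add_le _ _
      _ ≤ |2 * p t * p' t| * M + p t ^ 2 * (M * (1 + ‖c' n t‖)) := by
          rw [abs_mul _ (φ _), abs_mul (p t ^ 2), abs_of_nonneg (sq_nonneg (p t))]
          gcongr
          exact hM1 _
      _ = 2 * M * ‖p t * p' t‖ + M * (p t ^ 2 + p t ^ 2 * ‖c' n t‖) := by
          rw [mul_assoc, abs_mul 2, Real.norm_eq_abs]; simp; ring
      _ ≤ _ := by
          have := mul_le_mul_of_nonneg_left hcb hM0
          nlinarith

/-! ### Densities -/

lemma signed_bound {X : Type*} [MeasurableSpace X] (σ : SignedMeasure X) :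
    ∃ C : ℝ, ∀ s, MeasurableSet s → |σ s| ≤ C := by
  refine ⟨σ.toJordanDecomposition.posPart.real univ + σ.toJordanDecomposition.negPart.real univ,
    fun s hs => ?_⟩
  have h := σ.toSignedMeasure_toJordanDecomposition
  have : σ s = σ.toJordanDecomposition.posPart.real s - σ.toJordanDecomposition.negPart.real s := by
    conv_lhs => rw [← h]
    rw [JordanDecomposition.toSignedMeasure, _root_.sub_apply,
      Measure.toSignedMeasure_apply_measurable hs, Measure.toSignedMeasure_apply_measurable hs]
  rw [this]
  have h1 : σ.toJordanDecomposition.posPart.real s ≤ σ.toJordanDecomposition.posPart.real univ :=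
    measureReal_mono (subset_univ s)
  have h2 : σ.toJordanDecomposition.negPart.real s ≤ σ.toJordanDecomposition.negPart.real univ :=
    measureReal_mono (subset_univ s)
  have h3 : 0 ≤ σ.toJordanDecomposition.posPart.real s := measureReal_nonneg
  have h4 : 0 ≤ σ.toJordanDecomposition.negPart.real s := measureReal_nonneg
  rw [abs_le]; constructor <;> linarith

/-- a measurable function whose integrals over subsets of an exhausting sequence are bounded
is integrable -/
lemma integrable_of_bounded_setIntegral {X : Type*} [MeasurableSpace X] {lam : Measure X}
    {u : X → ℝ} (hu : Measurable u) {D : ℕ → Set X} (hD : ∀ n, MeasurableSet (D n))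
    (hmono : Monotone D) (hU : ⋃ n, D n = univ) (hi : ∀ n, IntegrableOn u (D n) lam) {C : ℝ}
    (h : ∀ n, ∀ s, MeasurableSet s → s ⊆ D n → |∫ x in s, u x ∂lam| ≤ C) : Integrable u lam := by
  have hpos : MeasurableSet {x | 0 ≤ u x} := measurableSet_le measurable_const hu
  have hbd : ∀ n, ∫⁻ x in D n, ‖u x‖ₑ ∂lam ≤ ENNReal.ofReal (2 * C) := by
    intro n
    have e1 : ∫⁻ x in D n, ‖u x‖ₑ ∂lam = ENNReal.ofReal (∫ x in D n, ‖u x‖ ∂lam) := by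
      rw [ofReal_integral_norm_eq_lintegral_enorm (hi n)]
    rw [e1]
    apply ENNReal.ofReal_le_ofReal
    rw [integral_norm_eq_pos_sub_neg (hi n)]
    have i1 := h n (D n ∩ {x | 0 ≤ u x}) ((hD n).inter hpos) inter_subset_left
    have i2 := h n (D n ∩ {x | u x < 0}) ((hD n).inter (measurableSet_lt hu measurable_const))
      inter_subset_left
    have i3 : ∫ x in {x | u x ≤ 0}, u x ∂(lam.restrict (D n))
        = ∫ x in {x | u x < 0}, u x ∂(lam.restrict (D n)) := by
      refine setIntegral_eq_of_subset_of_forall_sdiff_eq_zero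
        (measurableSet_le hu measurable_const) (fun x (hx : u x < 0) => (le_of_lt hx : u x ≤ 0)) ?_
      intro x hx
      have h1 : u x ≤ 0 := hx.1
      have h2 : ¬ u x < 0 := hx.2
      linarith
    rw [i3, Measure.restrict_restrict hpos, Measure.restrict_restrict
      (measurableSet_lt hu measurable_const), inter_comm, inter_comm {x | u x < 0}]
    rw [abs_le] at i1 i2
    linarith [i1.2, i2.1]
  refine ⟨hu.aestronglyMeasurable, ?_⟩
  have : ∫⁻ x, ‖u x‖ₑ ∂lam ≤ ENNReal.ofReal (2 * C) := by
    rw [← setLIntegral_univ, ← hU,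
      setLIntegral_iUnion_of_directed _ (hmono.directed_le)]
    exact iSup_le hbd
  exact this.trans_lt ENNReal.ofReal_lt_top

lemma integrable_of_isDensityS {σ : SignedMeasure (XX d)} {lam : Measure (XX d)}
    [IsFiniteMeasure lam] {u : XX d → ℝ} (hu : Measurable u) (h : IsDensityS σ lam u) :
    Integrable u lam := by
  obtain ⟨C, hC⟩ := signed_bound σ
  have hD : ∀ n : ℕ, MeasurableSet {x | |u x| ≤ n} := fun n =>
    measurableSet_le hu.abs measurable_const
  refine integrable_of_bounded_setIntegral (C := C) hu (D := fun n => {x | |u x| ≤ n}) hD ?_ ?_ ?_ ?_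
  · intro a b hab x hx
    have hx : |u x| ≤ (a:ℝ) := hx
    show |u x| ≤ (b:ℝ)
    exact le_trans hx (by exact_mod_cast hab)
  · ext x; simpa using exists_nat_ge |u x|
  · intro n
    refine IntegrableOn.of_bound (C := n) (measure_lt_top _ _) hu.aestronglyMeasurable ?_
    filter_upwards [ae_restrict_mem (hD n)] with x hx using hx
  · intro n s hs _
    rw [← h s hs]; exact hC s hs

lemma integrable_of_isDensityV {m : VectorMeasure (XX d) (Euc d)} {lam : Measure (XX d)}
    [IsFiniteMeasure lam] {w : XX d → Euc d} (hw : Measurable w) (h : IsDensityV m lam w) :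
    Integrable w lam := by
  have hcoord : ∀ i, Integrable (fun x => w x i) lam := by
    intro i
    have hwi : Measurable fun x => w x i :=
      (EuclideanSpace.proj i : Euc d →L[ℝ] ℝ).continuous.measurable.comp hw
    obtain ⟨C, hC⟩ := signed_bound (m.mapRange
      ((EuclideanSpace.proj i : Euc d →L[ℝ] ℝ).toLinearMap.toAddMonoidHom)
      (EuclideanSpace.proj i : Euc d →L[ℝ] ℝ).continuous)
    have hD : ∀ n : ℕ, MeasurableSet {x | ‖w x‖ ≤ n} := fun n =>
      measurableSet_le hw.norm measurable_const
    have hinteg : ∀ n : ℕ, IntegrableOn w {x | ‖w x‖ ≤ n} lam := by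
      intro n
      refine IntegrableOn.of_bound (C := n) (measure_lt_top _ _) hw.aestronglyMeasurable ?_
      filter_upwards [ae_restrict_mem (hD n)] with x hx using hx
    refine integrable_of_bounded_setIntegral (C := C) hwi (D := fun n => {x | ‖w x‖ ≤ n})
      hD ?_ ?_ ?_ ?_
    · intro a b hab x hx
      have hx : ‖w x‖ ≤ (a:ℝ) := hx
      show ‖w x‖ ≤ (b:ℝ)
      exact le_trans hx (by exact_mod_cast hab)
    · ext x; simpa using exists_nat_ge ‖w x‖
    · intro n
      exact (EuclideanSpace.proj i : Euc d →L[ℝ] ℝ).integrable_comp (hinteg n)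
    · intro n s hs hsub
      have h1 : |(m s) i| ≤ C := hC s hs
      rw [h s hs] at h1
      have h2 := (EuclideanSpace.proj i : Euc d →L[ℝ] ℝ).integral_comp_comm
        ((hinteg n).mono_set hsub)
      simp only [PiLp.proj_apply] at h2
      rw [h2]
      exact h1
  have h1 : Integrable (fun x => ∑ i, w x i • EuclideanSpace.single i (1:ℝ)) lam :=
    integrable_finsetSum _ fun i _ => (hcoord i).smul_const _
  convert h1 using 1
  ext1 x
  ext j
  simp [Pi.single_apply]

/-- integrals against two representations of the same signed measure coincide -/
lemma integral_mul_eq_of_density {X : Type*} [MeasurableSpace X] {lam P : Measure X}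
    {w v A : X → ℝ} (hw : Integrable w lam) (hv : Integrable v P)
    (hA : Measurable A) {M : ℝ} (hM : ∀ x, |A x| ≤ M)
    (h : ∀ s, MeasurableSet s → ∫ x in s, w x ∂lam = ∫ x in s, v x ∂P) :
    ∫ x, A x * w x ∂lam = ∫ x, A x * v x ∂P := by
  have key : ∀ A : SimpleFunc X ℝ, ∫ x, A x * w x ∂lam = ∫ x, A x * v x ∂P := by
    intro A
    induction A using SimpleFunc.induction with
    | @const c s hs =>
      have e : ∀ z : X → ℝ, (fun x => (SimpleFunc.piecewise s hs (SimpleFunc.const X c)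
        (SimpleFunc.const X 0)) x * z x) = indicator s (fun x => c * z x) := by
        intro z
        ext x
        by_cases hx : x ∈ s <;> simp [SimpleFunc.piecewise_apply, hx, indicator]
      rw [e, e, integral_indicator hs, integral_indicator hs, integral_const_mul,
        integral_const_mul, h _ hs]
    | add hd h1 h2 =>
      rename_i f g
      have bd : ∀ f : SimpleFunc X ℝ, ∃ C, ∀ x, ‖f x‖ ≤ C := fun f => f.exists_forall_norm_le
      obtain ⟨C1, hC1⟩ := bd f
      obtain ⟨C2, hC2⟩ := bd g
      simp only [SimpleFunc.coe_add, Pi.add_apply, add_mul]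
      rw [integral_add, integral_add, h1, h2]
      · exact hv.bdd_mul f.measurable.aestronglyMeasurable (Eventually.of_forall hC1)
      · exact hv.bdd_mul g.measurable.aestronglyMeasurable (Eventually.of_forall hC2)
      · exact hw.bdd_mul f.measurable.aestronglyMeasurable (Eventually.of_forall hC1)
      · exact hw.bdd_mul g.measurable.aestronglyMeasurable (Eventually.of_forall hC2)
  have hAs : StronglyMeasurable A := hA.stronglyMeasurable
  have hM0 : ∀ n x, ‖hAs.approxBounded M n x‖ ≤ |M| := by
    intro n x
    by_cases hne : 0 ≤ M
    · rw [abs_of_nonneg hne]; exact hAs.norm_approxBounded_le hne n x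
    · exact absurd ((abs_nonneg _).trans (hM x)) hne
  have lim : ∀ {Q : Measure X} {z : X → ℝ}, Integrable z Q →
      Tendsto (fun n => ∫ x, hAs.approxBounded M n x * z x ∂Q) atTop (𝓝 (∫ x, A x * z x ∂Q)) := by
    intro Q z hz
    refine tendsto_integral_of_dominated_convergence (fun x => |M| * ‖z x‖) ?_ (hz.norm.const_mul _)
      ?_ ?_
    · intro n
      exact (hAs.approxBounded M n).measurable.aestronglyMeasurable.mul hz.aestronglyMeasurable
    · intro n
      refine Eventually.of_forall fun x => ?_
      rw [norm_mul]
      gcongr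
      exact hM0 n x
    · refine Eventually.of_forall fun x => ?_
      exact (hAs.tendsto_approxBounded_of_norm_le (hM x)).mul_const _
  have l1 := lim hw
  have l2 := lim hv
  simp only [key] at l1
  exact tendsto_nhds_unique l1 l2

lemma integral_clm_eq_of_density {lam P : Measure (XX d)} {w v : XX d → Euc d}
    (hw : Integrable w lam) (hv : Integrable v P) {L : XX d → (XX d →L[ℝ] ℝ)}
    (hL : Continuous L) {M : ℝ} (hM : ∀ x, ‖L x‖ ≤ M)
    (h : ∀ s, MeasurableSet s → ∫ x in s, w x ∂lam = ∫ x in s, v x ∂P) :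
    ∫ x, L x ((0:ℝ), w x) ∂lam = ∫ x, L x ((0:ℝ), v x) ∂P := by
  have hM0 : 0 ≤ M := (norm_nonneg _).trans (hM 0)
  let A : Fin d → XX d → ℝ := fun i x => L x ((0:ℝ), EuclideanSpace.single i (1:ℝ))
  have hAc : ∀ i, Continuous (A i) := fun i => hL.clm_apply continuous_const
  have hAb : ∀ i x, |A i x| ≤ M := by
    intro i x
    refine ((L x).le_opNorm _).trans ?_
    have : ‖((0:ℝ), (EuclideanSpace.single i (1:ℝ) : Euc d))‖ ≤ 1 := by
      rw [Prod.norm_def]; simp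
    calc _ ≤ M * 1 := mul_le_mul (hM x) this (norm_nonneg _) hM0
      _ = M := mul_one M
  have hexp : ∀ x (z : Euc d), L x ((0:ℝ), z) = ∑ i, A i x * z i := by
    intro x z
    have : ((0:ℝ), z) = ∑ i, z i • ((0:ℝ), (EuclideanSpace.single i (1:ℝ) : Euc d)) := by
      ext j
      · simp [Prod.fst_sum]
      · simp [Prod.snd_sum, Pi.single_apply]
    rw [this, map_sum]
    refine Finset.sum_congr rfl fun i _ => ?_
    rw [map_smul, smul_eq_mul, mul_comm]
  have hci : ∀ {Q : Measure (XX d)} {z : XX d → Euc d} (i : Fin d), Integrable z Q →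
      Integrable (fun x => z x i) Q := fun i hz =>
    (EuclideanSpace.proj i : Euc d →L[ℝ] ℝ).integrable_comp hz
  simp only [hexp]
  rw [integral_finsetSum, integral_finsetSum]
  · refine Finset.sum_congr rfl fun i _ => ?_
    refine integral_mul_eq_of_density (hci i hw) (hci i hv) (hAc i).measurable (hAb i) ?_
    intro s hs
    have h1 := (EuclideanSpace.proj i : Euc d →L[ℝ] ℝ).integral_comp_comm
      (hw.restrict (s := s))
    have h2 := (EuclideanSpace.proj i : Euc d →L[ℝ] ℝ).integral_comp_comm
      (hv.restrict (s := s))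
    simp only [PiLp.proj_apply] at h1 h2
    rw [h1, h2, h s hs]
  · intro i _
    exact (hci i hv).bdd_mul (hAc i).aestronglyMeasurable (Eventually.of_forall (hAb i))
  · intro i _
    exact (hci i hw).bdd_mul (hAc i).aestronglyMeasurable (Eventually.of_forall (hAb i))

/-! ### The energy -/

lemma measurable_Psi {δ : ℝ} {r u : XX d → ℝ} {w : XX d → Euc d} (hr : Measurable r)
    (hw : Measurable w) (hu : Measurable u) : Measurable fun x => Psi δ (r x) (w x) (u x) := by
  unfold Psi
  refine Measurable.ite (measurableSet_lt measurable_const hr) ?_ ?_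
  · exact ENNReal.measurable_ofReal.comp
      (((hw.norm.pow_const 2).add ((hu.pow_const 2).const_mul _)).div (hr.const_mul 2))
  · refine Measurable.ite ?_ measurable_const measurable_const
    exact (hr (measurableSet_singleton 0)).inter
      ((hw (measurableSet_singleton 0)).inter (hu (measurableSet_singleton 0)))

/-- the energy of velocity fields -/
def EnP (δ : ℝ) (P : Measure (XX d)) (v : XX d → Euc d) (g : XX d → ℝ) : ℝ≥0∞ :=
  ∫⁻ x, ENNReal.ofReal ((‖v x‖ ^ 2 + δ ^ 2 * g x ^ 2) / 2) ∂P

lemma candidate {δ : ℝ} {P lam : Measure (XX d)} {m : VectorMeasure (XX d) (Euc d)}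
    {μ : SignedMeasure (XX d)} {r u : XX d → ℝ} {w : XX d → Euc d}
    (hr : Measurable r) (hw : Measurable w) (hu : Measurable u) (hr0 : ∀ x, 0 ≤ r x)
    (hP : IsDensityP P lam r) (hm : IsDensityV m lam w) (hμ : IsDensityS μ lam u)
    (hfin : ∫⁻ x, Psi δ (r x) (w x) (u x) ∂lam ≠ ⊤) :
    IsDensityV m P (fun x => (r x)⁻¹ • w x) ∧ IsDensityS μ P (fun x => (r x)⁻¹ * u x) ∧
    ∫⁻ x, Psi δ (r x) (w x) (u x) ∂lam
      = EnP δ P (fun x => (r x)⁻¹ • w x) (fun x => (r x)⁻¹ * u x) := by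
  have hPe : P = lam.withDensity (fun x => ENNReal.ofReal (r x)) := by
    ext s hs
    rw [hP s hs, withDensity_apply _ hs]
  have hae : ∀ᵐ x ∂lam, 0 < r x ∨ (r x = 0 ∧ w x = 0 ∧ u x = 0) := by
    filter_upwards [ae_lt_top (measurable_Psi hr hw hu) hfin] with x hx
    unfold Psi at hx
    by_cases h1 : 0 < r x
    · exact Or.inl h1
    · rw [if_neg h1] at hx
      by_cases h2 : r x = 0 ∧ w x = 0 ∧ u x = 0
      · exact Or.inr h2
      · rw [if_neg h2] at hx
        exact absurd hx (lt_irrefl _)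
  have hrm : Measurable fun x => (r x).toNNReal := hr.real_toNNReal
  have hPe2 : P = lam.withDensity (fun x => ((r x).toNNReal : ℝ≥0∞)) := hPe
  refine ⟨?_, ?_, ?_⟩
  · intro s hs
    rw [hm s hs, hPe2, setIntegral_withDensity_eq_setIntegral_smul hrm _ hs]
    refine integral_congr_ae (ae_restrict_of_ae ?_)
    filter_upwards [hae] with x hx
    rcases hx with hx | hx
    · rw [NNReal.smul_def, Real.coe_toNNReal _ hx.le, smul_smul, mul_inv_cancel₀ hx.ne', one_smul]
    · simp [hx.2.1]
  · intro s hs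
    rw [hμ s hs, hPe2, setIntegral_withDensity_eq_setIntegral_smul hrm _ hs]
    refine integral_congr_ae (ae_restrict_of_ae ?_)
    filter_upwards [hae] with x hx
    rcases hx with hx | hx
    · rw [NNReal.smul_def, Real.coe_toNNReal _ hx.le, smul_eq_mul, ← mul_assoc,
        mul_inv_cancel₀ hx.ne', one_mul]
    · simp [hx.2.2]
  · unfold EnP
    rw [hPe, lintegral_withDensity_eq_lintegral_mul _ hr.ennreal_ofReal]
    · refine lintegral_congr_ae ?_
      filter_upwards [hae] with x hx
      rcases hx with hx | hx
      · rw [Pi.mul_apply, Psi, if_pos hx, ← ENNReal.ofReal_mul hx.le, norm_smul, norm_inv,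
          Real.norm_of_nonneg hx.le]
        congr 1
        field_simp
      · simp [Psi, hx.1, hx.2.1, hx.2.2]
    · have h1 : Measurable (fun x => (r x)⁻¹ • w x) := hr.inv.smul hw
      have h2 : Measurable (fun x => (r x)⁻¹ * u x) := hr.inv.mul hu
      exact ENNReal.measurable_ofReal.comp
        (((h1.norm.pow_const 2).add ((h2.pow_const 2).const_mul _)).div_const 2)

lemma isDensityP_one (P : Measure (XX d)) : IsDensityP P P (fun _ => 1) := by
  intro s hs
  simp

lemma Bdelta_eq {δ : ℝ} {P : Measure (XX d)} [IsFiniteMeasure P]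
    {m : VectorMeasure (XX d) (Euc d)} {μ : SignedMeasure (XX d)} {v : XX d → Euc d}
    {g : XX d → ℝ} (hv : Measurable v) (hg : Measurable g) (hm : IsDensityV m P v)
    (hμ : IsDensityS μ P g) : BdeltaMeas δ P m μ = EnP δ P v g := by
  apply le_antisymm
  · refine sInf_le ⟨P, inferInstance, fun _ => 1, v, g, measurable_const, hv, hg,
      fun _ => zero_le_one, isDensityP_one P, hm, hμ, ?_⟩
    simp [EnP, Psi]
  · refine le_sInf ?_
    rintro c ⟨lam, hlam, r, w, u, hr, hw, hu, hr0, hP, hmw, hμu, rfl⟩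
    by_cases hfin : ∫⁻ x, Psi δ (r x) (w x) (u x) ∂lam = ⊤
    · rw [hfin]; exact le_top
    obtain ⟨h1, h2, h3⟩ := candidate hr hw hu hr0 hP hmw hμu hfin
    rw [h3]
    refine le_of_eq (lintegral_congr_ae ?_)
    have e1 : v =ᵐ[P] fun x => (r x)⁻¹ • w x :=
      Integrable.ae_eq_of_forall_setIntegral_eq _ _ (integrable_of_isDensityV hv hm)
        (integrable_of_isDensityV (hr.inv.smul hw) h1)
        (fun s hs _ => by rw [← hm s hs, ← h1 s hs])
    have e2 : g =ᵐ[P] fun x => (r x)⁻¹ * u x :=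
      Integrable.ae_eq_of_forall_setIntegral_eq _ _ (integrable_of_isDensityS hg hμ)
        (integrable_of_isDensityS (hr.inv.mul hu) h2)
        (fun s hs _ => by rw [← hμ s hs, ← h2 s hs])
    filter_upwards [e1, e2] with x hx1 hx2
    rw [hx1, hx2]

lemma exists_velocity {δ : ℝ} {P : Measure (XX d)}
    {m : VectorMeasure (XX d) (Euc d)} {μ : SignedMeasure (XX d)}
    (h : BdeltaMeas δ P m μ ≠ ⊤) : ∃ (v : XX d → Euc d) (g : XX d → ℝ), Measurable v ∧
      Measurable g ∧ IsDensityV m P v ∧ IsDensityS μ P g := by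
  obtain ⟨c, ⟨lam, hlam, r, w, u, hr, hw, hu, hr0, hP, hmw, hμu, rfl⟩, hc⟩ :=
    sInf_lt_iff.1 (lt_top_iff_ne_top.2 h)
  obtain ⟨h1, h2, h3⟩ := candidate hr hw hu hr0 hP hmw hμu hc.ne
  exact ⟨_, _, hr.inv.smul hw, hr.inv.mul hu, h1, h2⟩

/-! ### The measure of a curve -/

/-- the measure `k dt ⊗ δ_z` -/
def curveP (k : ℝ → ℝ) (z : ℝ → Euc d) : Measure (XX d) :=
  ((volume.restrict (Ioo (0:ℝ) 1)).withDensity fun t => ENNReal.ofReal (k t)).map fun t => (t, z t)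

lemma clamp_mem (t : ℝ) : clamp t ∈ Icc (0:ℝ) 1 := by
  unfold clamp
  exact ⟨le_max_left _ _, max_le zero_le_one (min_le_left _ _)⟩

lemma clamp_of_mem {t : ℝ} (ht : t ∈ Icc (0:ℝ) 1) : clamp t = t := by
  unfold clamp
  rw [min_eq_right ht.2, max_eq_right ht.1]

lemma curve_data {V : Set (Euc d)} (hVb : Bornology.IsBounded V) {η : SCurve V} {γ : ℝ → Euc d}
    {h : ℝ → ℝ} (hrep : Represents η γ h) {P : Measure (XX d)} (hP : CurveMeasure η P) :
    ∃ (k : ℝ → ℝ) (y z : ℝ → Euc d) (R : ℝ), 0 ≤ R ∧ Continuous k ∧ Continuous y ∧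
      Measurable z ∧ (∀ t, 0 ≤ k t) ∧ (∀ t, ‖z t‖ ≤ R) ∧ (∀ t, y t = k t • z t) ∧
      (∀ t ∈ Icc (0:ℝ) 1, h t = k t) ∧ (∀ t ∈ Icc (0:ℝ) 1, 0 < k t → γ t = z t) ∧
      P = curveP k z := by
  obtain ⟨R, hR0, hR⟩ := hVb.exists_pos_norm_le
  have hη : ∀ t, η.toFun t = ENNReal.ofReal (h (clamp t)) • Measure.dirac (γ (clamp t)) := by
    intro t
    rw [η.clamped t]
    exact (hrep _ (clamp_mem t)).2.2
  have hk0 : ∀ t, 0 ≤ h (clamp t) := fun t => (hrep _ (clamp_mem t)).1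
  have hinteg : ∀ (φ : Euc d → ℝ) t, ∫ x, φ x ∂(η.toFun t) = h (clamp t) * φ (γ (clamp t)) := by
    intro φ t
    rw [hη t, integral_smul_measure, integral_dirac, ENNReal.toReal_ofReal (hk0 t), smul_eq_mul]
  have hkc : Continuous fun t => h (clamp t) := by
    have := η.narrow (fun _ => 1) continuous_const
    simp only [hinteg, mul_one] at this
    exact this
  have hyc : Continuous fun t => h (clamp t) • γ (clamp t) := by
    have : ∀ i, Continuous fun t => h (clamp t) * γ (clamp t) i := by
      intro i
      have := η.narrow (fun x => x i) (EuclideanSpace.proj i : Euc d →L[ℝ] ℝ).continuous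
      simp only [hinteg] at this
      exact this
    exact (PiLp.continuous_toLp 2 _).comp (continuous_pi this)
  have hzm : Measurable fun t => (h (clamp t))⁻¹ • (h (clamp t) • γ (clamp t)) :=
    hkc.measurable.inv.smul hyc.measurable
  have hz1 : ∀ t, 0 < h (clamp t) → (h (clamp t))⁻¹ • (h (clamp t) • γ (clamp t)) = γ (clamp t) := by
    intro t ht
    rw [smul_smul, inv_mul_cancel₀ ht.ne', one_smul]
  refine ⟨fun t => h (clamp t), fun t => h (clamp t) • γ (clamp t),
    fun t => (h (clamp t))⁻¹ • (h (clamp t) • γ (clamp t)), R, hR0.le, hkc, hyc, hzm, hk0,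
    ?_, ?_, ?_, ?_, ?_⟩
  · intro t
    rcases (hk0 t).eq_or_lt with h0 | h0
    · simp only [← h0, inv_zero, zero_smul, norm_zero]; exact hR0.le
    · simp only [hz1 t h0]
      exact hR _ (hrep _ (clamp_mem t)).2.1
  · intro t
    rcases (hk0 t).eq_or_lt with h0 | h0
    · simp only [← h0, zero_smul]
    · simp only [hz1 t h0]
  · intro t ht
    simp only [clamp_of_mem ht]
  · intro t ht h0
    have := hz1 t h0
    simp only [this]
    rw [clamp_of_mem ht]
  · ext s hs
    have hm : Measurable fun t : ℝ => (t, (h (clamp t))⁻¹ • (h (clamp t) • γ (clamp t))) :=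
      measurable_id.prodMk hzm
    rw [hP s hs, curveP, Measure.map_apply hm hs, withDensity_apply _ (hm hs),
      ← lintegral_indicator (hm hs)]
    refine lintegral_congr fun t => ?_
    have hms : MeasurableSet {x | (t, x) ∈ s} := measurable_prodMk_left hs
    rw [hη t, Measure.smul_apply, Measure.dirac_apply' _ hms, smul_eq_mul]
    rcases (hk0 t).eq_or_lt with h0 | h0
    · simp [← h0, indicator]
    · by_cases hts : (t, γ (clamp t)) ∈ s
      · rw [indicator_of_mem (show γ (clamp t) ∈ {x | (t, x) ∈ s} from hts),
          indicator_of_mem (by rw [mem_preimage, hz1 t h0]; exact hts)]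
        simp
      · rw [indicator_of_notMem (show γ (clamp t) ∉ {x | (t, x) ∈ s} from hts),
          indicator_of_notMem (by rw [mem_preimage, hz1 t h0]; exact hts)]
        simp

lemma lintegral_curveP {k : ℝ → ℝ} {z : ℝ → Euc d} (hk : Continuous k) (hz : Measurable z)
    {f : XX d → ℝ≥0∞} (hf : Measurable f) :
    ∫⁻ x, f x ∂(curveP k z) = ∫⁻ t in Ioo (0:ℝ) 1, ENNReal.ofReal (k t) * f (t, z t) := by
  have hm : Measurable fun t : ℝ => (t, z t) := measurable_id.prodMk hz
  rw [curveP, lintegral_map hf hm, lintegral_withDensity_eq_lintegral_mul _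
    hk.measurable.ennreal_ofReal (show Measurable fun t => f (t, z t) from hf.comp hm)]
  rfl

lemma finite_curveP {k : ℝ → ℝ} {z : ℝ → Euc d} (hk : Continuous k) (hz : Measurable z) :
    IsFiniteMeasure (curveP k z) := by
  constructor
  rw [← lintegral_one, lintegral_curveP hk hz measurable_const]
  simp only [mul_one]
  have : IntegrableOn k (Ioo 0 1) := (hk.integrableOn_Icc).mono_set Ioo_subset_Icc_self
  refine lt_of_le_of_lt (lintegral_mono fun t => ?_) this.2
  rw [← ofReal_norm]
  exact ENNReal.ofReal_le_ofReal (le_abs_self _)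

lemma integral_curveP {F : Type*} [NormedAddCommGroup F] [NormedSpace ℝ F]
    {k : ℝ → ℝ} {z : ℝ → Euc d} (hk : Continuous k) (hk0 : ∀ t, 0 ≤ k t) (hz : Measurable z)
    {f : XX d → F} (hf : StronglyMeasurable f) :
    ∫ x, f x ∂(curveP k z) = ∫ t in Ioo (0:ℝ) 1, k t • f (t, z t) := by
  have hm : Measurable fun t : ℝ => (t, z t) := measurable_id.prodMk hz
  rw [curveP, integral_map hm.aemeasurable hf.aestronglyMeasurable]
  have := integral_withDensity_eq_integral_smul (μ := volume.restrict (Ioo (0:ℝ) 1))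
    hk.measurable.real_toNNReal (fun t => f (t, z t))
  refine this.trans (integral_congr_ae (Eventually.of_forall fun t => ?_))
  simp only [NNReal.smul_def, Real.coe_toNNReal _ (hk0 t)]

lemma integrable_curveP {F : Type*} [NormedAddCommGroup F] [NormedSpace ℝ F]
    {k : ℝ → ℝ} {z : ℝ → Euc d} (hk : Continuous k) (hk0 : ∀ t, 0 ≤ k t) (hz : Measurable z)
    {f : XX d → F} (hf : StronglyMeasurable f) :
    Integrable f (curveP k z) ↔ IntegrableOn (fun t => k t • f (t, z t)) (Ioo (0:ℝ) 1) := by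
  have hm : Measurable fun t : ℝ => (t, z t) := measurable_id.prodMk hz
  rw [curveP, integrable_map_measure hf.aestronglyMeasurable hm.aemeasurable]
  have := integrable_withDensity_iff_integrable_smul (μ := volume.restrict (Ioo (0:ℝ) 1))
    hk.measurable.real_toNNReal (g := fun t => f (t, z t))
  refine this.trans (integrable_congr (Eventually.of_forall fun t => ?_))
  simp only [NNReal.smul_def, Real.coe_toNNReal _ (hk0 t)]

/-- the energy formula -/
lemma J_formula {α β δ : ℝ} (hα : 0 < α) (hβ : 0 < β) {k : ℝ → ℝ} {z : ℝ → Euc d}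
    (hk : Continuous k) (hk0 : ∀ t, 0 ≤ k t) (hz : Measurable z)
    {v : XX d → Euc d} {g : XX d → ℝ} (hv : Measurable v) (hg : Measurable g)
    {γ : ℝ → Euc d} {h : ℝ → ℝ} (hh : ∀ t ∈ Icc (0:ℝ) 1, h t = k t)
    (hγ : ∀ t ∈ Icc (0:ℝ) 1, 0 < k t → γ t = z t) :
    ENNReal.ofReal β * EnP δ (curveP k z) v g + ENNReal.ofReal α * curveP k z univ
      = ∫⁻ t in {t | t ∈ Ioo (0:ℝ) 1 ∧ 0 < h t},
                ENNReal.ofReal (β / 2 * ‖v (t, γ t)‖ ^ 2 * h t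
                  + β * δ ^ 2 / 2 * (g (t, γ t) * h t) ^ 2 / h t + α * h t) := by
  have hset : {t | t ∈ Ioo (0:ℝ) 1 ∧ 0 < h t} = {t | 0 < k t} ∩ Ioo 0 1 := by
    ext t
    constructor
    · rintro ⟨h1, h2⟩
      exact ⟨by simpa [hh t (Ioo_subset_Icc_self h1)] using h2, h1⟩
    · rintro ⟨h1, h2⟩
      exact ⟨h2, by simpa [hh t (Ioo_subset_Icc_self h2)] using h1⟩
  have hms : MeasurableSet {t | 0 < k t} := measurableSet_lt measurable_const hk.measurable
  have hEm : Measurable fun x : XX d => ENNReal.ofReal ((‖v x‖ ^ 2 + δ ^ 2 * g x ^ 2) / 2) :=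
    (((hv.norm.pow_const 2).add ((hg.pow_const 2).const_mul _)).div_const 2).ennreal_ofReal
  have hm : Measurable fun t : ℝ => (t, z t) := measurable_id.prodMk hz
  have hSm : Measurable fun x : XX d => ENNReal.ofReal β *
      ENNReal.ofReal ((‖v x‖ ^ 2 + δ ^ 2 * g x ^ 2) / 2) + ENNReal.ofReal α * 1 :=
    (hEm.const_mul _).add measurable_const
  rw [EnP, ← lintegral_one, ← lintegral_const_mul _ hEm, ← lintegral_const_mul _ measurable_const,
    ← lintegral_add_left (hEm.const_mul _), lintegral_curveP hk hz hSm, hset, ← Measure.restrict_restrict hms,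
      ← lintegral_indicator hms]
  refine lintegral_congr_ae ?_
  filter_upwards [ae_restrict_mem measurableSet_Ioo] with t ht
  have ht' := Ioo_subset_Icc_self ht
  rcases (hk0 t).eq_or_lt with h0 | h0
  · simp [← h0, indicator]
  · have : t ∈ {t | 0 < k t} := h0
    rw [indicator_of_mem this, hh t ht', hγ t ht' h0, mul_one, ← ENNReal.ofReal_mul hβ.le,
      ← ENNReal.ofReal_add (by positivity) hα.le, ← ENNReal.ofReal_mul h0.le]
    congr 1
    field_simp

/-! ### From the continuity equation to the characteristic system -/

lemma exists_test {ψ : ℝ → ℝ} (hψ : IsTest1 ψ) (c : ℝ) (a : Euc d) {R : ℝ} (hR : 0 ≤ R) :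
    ∃ φ : XX d → ℝ, IsTest φ ∧ ∀ (t : ℝ) (x : Euc d), ‖x‖ ≤ R →
      fderiv ℝ φ (t, x) ((1:ℝ), (0 : Euc d)) = deriv ψ t * (c + inner ℝ a x) ∧
      (∀ w : Euc d, fderiv ℝ φ (t, x) ((0:ℝ), w) = ψ t * inner ℝ a w) ∧
      φ (t, x) = ψ t * (c + inner ℝ a x) := by
  let χ : ContDiffBump (0 : Euc d) := ⟨R + 1, R + 2, by linarith, by linarith⟩
  let φ : XX d → ℝ := fun p => ψ p.1 * χ p.2 * (c + inner ℝ a p.2)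
  have hsm : ContDiff ℝ (⊤ : ℕ∞) φ := by
    refine ((hψ.1.comp contDiff_fst).mul (χ.contDiff.comp contDiff_snd)).mul ?_
    exact contDiff_const.add (contDiff_const.inner ℝ contDiff_snd)
  have hK : IsCompact (tsupport ψ ×ˢ Metric.closedBall (0 : Euc d) (R + 2)) :=
    hψ.2.1.isCompact.prod (isCompact_closedBall _ _)
  have hz : ∀ p, p ∉ tsupport ψ ×ˢ Metric.closedBall (0 : Euc d) (R + 2) → φ p = 0 := by
    intro p hp
    by_cases h1 : p.1 ∈ tsupport ψ
    · have h2 : p.2 ∉ Metric.closedBall (0 : Euc d) (R + 2) := fun h => hp ⟨h1, h⟩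
      have : χ p.2 = 0 := by
        apply χ.zero_of_le_dist
        rw [Metric.mem_closedBall, not_le] at h2
        exact h2.le
      simp [φ, this]
    · simp [φ, image_eq_zero_of_notMem_tsupport h1]
  refine ⟨φ, ⟨hsm, HasCompactSupport.intro hK hz, ?_⟩, ?_⟩
  · have : tsupport φ ⊆ tsupport ψ ×ˢ Metric.closedBall (0 : Euc d) (R + 2) := by
      refine closure_minimal ?_ hK.isClosed
      intro p hp
      by_contra h
      exact hp (hz p h)
    exact fun p hp => ⟨hψ.2.2 (this hp).1, mem_univ _⟩
  · intro t x hx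
    have hev : φ =ᶠ[𝓝 (t, x)] fun p => ψ p.1 * (c + inner ℝ a p.2) := by
      have h1 : ∀ᶠ y in 𝓝 x, χ y = 1 := by
        have : Metric.ball (0 : Euc d) (R + 1) ∈ 𝓝 x := by
          apply Metric.isOpen_ball.mem_nhds
          rw [mem_ball_zero_iff]; linarith
        filter_upwards [this] with y hy
        exact χ.one_of_mem_closedBall (Metric.ball_subset_closedBall hy)
      have h2 : ∀ᶠ p : XX d in 𝓝 (t, x), χ p.2 = 1 :=
        (continuous_snd.tendsto' (t, x) x rfl).eventually h1
      filter_upwards [h2] with p hp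
      simp only [φ, hp, mul_one]
    have hd1 : HasFDerivAt (fun p : XX d => ψ p.1)
        ((deriv ψ t) • ContinuousLinearMap.fst ℝ ℝ (Euc d)) (t, x) := by
      have : HasDerivAt ψ (deriv ψ t) t :=
        (hψ.1.differentiable (by simp)).differentiableAt.hasDerivAt
      exact this.comp_hasFDerivAt (t, x) hasFDerivAt_fst
    have hd2 : HasFDerivAt (fun p : XX d => c + inner ℝ a p.2)
        ((innerSL ℝ a).comp (ContinuousLinearMap.snd ℝ ℝ (Euc d))) (t, x) := by
      have : HasFDerivAt (fun p : XX d => innerSL ℝ a p.2)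
        ((innerSL ℝ a).comp (ContinuousLinearMap.snd ℝ ℝ (Euc d))) (t, x) :=
        (innerSL ℝ a).hasFDerivAt.comp _ hasFDerivAt_snd
      exact this.const_add c
    have hd := (hd1.mul hd2).congr_of_eventuallyEq hev
    rw [hd.fderiv, hev.eq_of_nhds]
    refine ⟨?_, ?_, rfl⟩
    · simp [mul_comm]
    · intro w
      simp

lemma ce_curve {k : ℝ → ℝ} {z : ℝ → Euc d} (hk : Continuous k) (hk0 : ∀ t, 0 ≤ k t)
    (hz : Measurable z) {v : XX d → Euc d} {g : XX d → ℝ} (hv : Measurable v) (hg : Measurable g)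
    (hvi : Integrable v (curveP k z)) (hgi : Integrable g (curveP k z)) {φ : XX d → ℝ}
    (hφ : IsTest φ) :
    (∫ x, fderiv ℝ φ x ((1:ℝ), (0 : Euc d)) ∂(curveP k z)) +
      (∫ x, fderiv ℝ φ x ((0:ℝ), v x) ∂(curveP k z)) + ∫ x, φ x * g x ∂(curveP k z)
    = ∫ t in (0:ℝ)..1, k t * (fderiv ℝ φ (t, z t) ((1:ℝ), (0 : Euc d))
      + fderiv ℝ φ (t, z t) ((0:ℝ), v (t, z t)) + φ (t, z t) * g (t, z t)) := by
  obtain ⟨M, hM0, hM1, hM2⟩ := hφ.bounds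
  have := finite_curveP hk hz
  have hfc : Continuous (fderiv ℝ φ) := hφ.1.continuous_fderiv (by simp)
  have hm2 : Measurable fun x => fderiv ℝ φ x ((0:ℝ), v x) := by
    have : Continuous fun q : (XX d →L[ℝ] ℝ) × XX d => q.1 q.2 := isBoundedBilinearMap_apply.continuous
    have h2 : Measurable fun x : XX d => ((fderiv ℝ φ x, ((0:ℝ), v x)) : (XX d →L[ℝ] ℝ) × XX d) :=
      hfc.measurable.prodMk (measurable_const.prodMk hv)
    exact this.measurable.comp h2
  have hc1 : Continuous fun x => fderiv ℝ φ x ((1:ℝ), (0 : Euc d)) := hfc.clm_apply continuous_const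
  have i1 : Integrable (fun x => fderiv ℝ φ x ((1:ℝ), (0 : Euc d))) (curveP k z) := by
    refine Integrable.of_bound hc1.aestronglyMeasurable (M * ‖((1:ℝ), (0 : Euc d))‖)
      (Eventually.of_forall fun x => ?_)
    exact ((fderiv ℝ φ x).le_opNorm _).trans (by gcongr; exact hM2 x)
  have i2 : Integrable (fun x => fderiv ℝ φ x ((0:ℝ), v x)) (curveP k z) := by
    refine (hvi.norm.const_mul M).mono' hm2.aestronglyMeasurable (Eventually.of_forall fun x => ?_)
    refine ((fderiv ℝ φ x).le_opNorm _).trans ?_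
    have : ‖((0:ℝ), v x)‖ = ‖v x‖ := by rw [Prod.norm_def]; simp
    rw [this]
    gcongr
    exact hM2 x
  have i3 : Integrable (fun x => φ x * g x) (curveP k z) :=
    hgi.bdd_mul hφ.1.continuous.aestronglyMeasurable (Eventually.of_forall hM1)
  have i12 : Integrable (fun x => fderiv ℝ φ x ((1:ℝ), (0 : Euc d)) + fderiv ℝ φ x ((0:ℝ), v x))
    (curveP k z) := i1.add i2
  rw [← integral_add i1 i2, ← integral_add i12 i3, intervalIntegral.integral_of_le
    zero_le_one, integral_Ioc_eq_integral_Ioo]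
  refine integral_curveP hk hk0 hz (f := fun x => fderiv ℝ φ x ((1:ℝ), (0 : Euc d))
    + fderiv ℝ φ x ((0:ℝ), v x) + φ x * g x) (Measurable.stronglyMeasurable ?_)
  exact (hc1.measurable.add hm2).add (hφ.1.continuous.measurable.mul hg)

lemma integrableOn_Icc_of_Ioo {F : Type*} [NormedAddCommGroup F] {f : ℝ → F}
    (h : IntegrableOn f (Ioo (0:ℝ) 1)) : IntegrableOn f (Icc (0:ℝ) 1) := by
  rwa [IntegrableOn, ← restrict_Ioo_eq_restrict_Icc]

lemma prim_of_ce {k : ℝ → ℝ} {y z : ℝ → Euc d} {R : ℝ} (hR : 0 ≤ R) (hk : Continuous k)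
    (hyc : Continuous y) (hz : Measurable z) (hk0 : ∀ t, 0 ≤ k t) (hzR : ∀ t, ‖z t‖ ≤ R)
    (hy : ∀ t, y t = k t • z t) {m : VectorMeasure (XX d) (Euc d)} {μ : SignedMeasure (XX d)}
    {v : XX d → Euc d} {g : XX d → ℝ} (hv : Measurable v) (hg : Measurable g)
    (hm : IsDensityV m (curveP k z) v) (hμ : IsDensityS μ (curveP k z) g)
    (hce : SolvesCEMeas (curveP k z) m μ) (c : ℝ) (a : Euc d) :
    IsPrim (fun t => c * k t + inner ℝ a (y t))
      (fun t => k t * inner ℝ a (v (t, z t)) + g (t, z t) * (c * k t + inner ℝ a (y t))) := by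
  have hfin := finite_curveP hk hz
  have hvi := integrable_of_isDensityV hv hm
  have hgi := integrable_of_isDensityS hg hμ
  have hvi' := (integrable_curveP hk hk0 hz hv.stronglyMeasurable).1 hvi
  have hgi' := (integrable_curveP hk hk0 hz hg.stronglyMeasurable).1 hgi
  have hin : ∀ t, inner ℝ a (y t) = k t * inner ℝ a (z t) := by
    intro t; rw [hy, inner_smul_right]
  have hfc : Continuous fun t => c * k t + inner ℝ a (y t) := by fun_prop
  refine du_bois_reymond hfc.continuousOn ?_ ?_
  · apply integrableOn_Icc_of_Ioo
    have h1 : IntegrableOn (fun t => k t * inner ℝ a (v (t, z t))) (Ioo (0:ℝ) 1) := by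
      have : IntegrableOn (fun t => inner ℝ a (k t • v (t, z t))) (Ioo (0:ℝ) 1) :=
        hvi'.const_inner a
      simpa only [inner_smul_right] using this
    have h2 : IntegrableOn (fun t => (c + inner ℝ a (z t)) * (k t * g (t, z t))) (Ioo (0:ℝ) 1) := by
      refine Integrable.bdd_mul (c := |c| + ‖a‖ * R) hgi' ?_ (Eventually.of_forall fun t => ?_)
      · exact (measurable_const.add (measurable_const (a := a).inner hz)).aestronglyMeasurable
      · refine (norm_add_le _ _).trans ?_
        refine add_le_add le_rfl ((norm_inner_le_norm (𝕜 := ℝ) a (z t)).trans ?_)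
        gcongr
        exact hzR t
    refine (h1.add h2).congr (Eventually.of_forall fun t => ?_)
    simp only [Pi.add_apply, hin]
    ring
  · intro ψ hψ
    obtain ⟨φ, hφ, hφ1⟩ := exists_test hψ c a hR
    have h1 := hce _ hfin v g hv hg hm hμ φ hφ
    rw [ce_curve hk hk0 hz hv hg hvi hgi hφ] at h1
    refine Eq.trans ?_ h1
    refine intervalIntegral.integral_congr fun t _ => ?_
    obtain ⟨e1, e2, e3⟩ := hφ1 t (z t) (hzR t)
    simp only [e1, e2, e3, hin]
    ring

lemma L2_of_energy {δ : ℝ} (hδ : 0 < δ) {k : ℝ → ℝ} {z : ℝ → Euc d} (hk : Continuous k)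
    (hk0 : ∀ t, 0 ≤ k t) (hz : Measurable z) {v : XX d → Euc d} {g : XX d → ℝ}
    (hv : Measurable v) (hg : Measurable g) (hE : EnP δ (curveP k z) v g ≠ ⊤) :
    IntegrableOn (fun t => k t * ‖v (t, z t)‖ ^ 2) (Icc (0:ℝ) 1) ∧
    IntegrableOn (fun t => k t * g (t, z t) ^ 2) (Icc (0:ℝ) 1) := by
  have hm : Measurable fun t : ℝ => (t, z t) := measurable_id.prodMk hz
  have hV : Measurable fun t => v (t, z t) := hv.comp hm
  have hG : Measurable fun t => g (t, z t) := hg.comp hm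
  have hEm : Measurable fun x : XX d => ENNReal.ofReal ((‖v x‖ ^ 2 + δ ^ 2 * g x ^ 2) / 2) :=
    (((hv.norm.pow_const 2).add ((hg.pow_const 2).const_mul _)).div_const 2).ennreal_ofReal
  have hI : Integrable (fun t => k t * ((‖v (t, z t)‖ ^ 2 + δ ^ 2 * g (t, z t) ^ 2) / 2))
      (volume.restrict (Ioo (0:ℝ) 1)) := by
    rw [← lintegral_ofReal_ne_top_iff_integrable]
    · rw [EnP, lintegral_curveP hk hz hEm] at hE
      convert hE using 4 with t
      rw [ENNReal.ofReal_mul (hk0 _)]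
    · exact (hk.measurable.mul (((hV.norm.pow_const 2).add
        ((hG.pow_const 2).const_mul _)).div_const 2)).aestronglyMeasurable
    · exact Eventually.of_forall fun t => mul_nonneg (hk0 t) (by positivity)
  constructor
  · apply integrableOn_Icc_of_Ioo
    refine (hI.const_mul 2).mono' (hk.measurable.mul (hV.norm.pow_const 2)).aestronglyMeasurable
      (Eventually.of_forall fun t => ?_)
    have := hk0 t
    rw [Real.norm_of_nonneg (by positivity)]
    have : 0 ≤ k t * (δ ^ 2 * g (t, z t) ^ 2) := by positivity
    linarith
  · apply integrableOn_Icc_of_Ioo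
    refine (hI.const_mul (2 / δ ^ 2)).mono' (hk.measurable.mul (hG.pow_const 2)).aestronglyMeasurable
      (Eventually.of_forall fun t => ?_)
    have := hk0 t
    rw [Real.norm_of_nonneg (by positivity)]
    have e : 2 / δ ^ 2 * (k t * ((‖v (t, z t)‖ ^ 2 + δ ^ 2 * g (t, z t) ^ 2) / 2))
      = k t * ‖v (t, z t)‖ ^ 2 / δ ^ 2 + k t * g (t, z t) ^ 2 := by field_simp
    rw [e]
    have : 0 ≤ k t * ‖v (t, z t)‖ ^ 2 / δ ^ 2 := by positivity
    linarith

lemma integrableOn_sqrt_mul {k f : ℝ → ℝ} (hk : Continuous k) (hk0 : ∀ t, 0 ≤ k t)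
    (hf : Measurable f) (h : IntegrableOn (fun t => k t * f t ^ 2) (Icc (0:ℝ) 1)) :
    IntegrableOn (fun t => √(k t) * |f t|) (Icc (0:ℝ) 1) := by
  have h1 : IntegrableOn (fun _ : ℝ => (1:ℝ)) (Icc (0:ℝ) 1) := by simp
  refine (h1.add h).mono' (hk.measurable.sqrt.mul hf.abs).aestronglyMeasurable
    (Eventually.of_forall fun t => ?_)
  rw [Real.norm_of_nonneg (by positivity)]
  have e : k t * f t ^ 2 = (√(k t) * |f t|) ^ 2 := by
    rw [mul_pow, Real.sq_sqrt (hk0 t), sq_abs]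
  simp only [Pi.add_apply, e]
  nlinarith [sq_nonneg (√(k t) * |f t| - 1), sq_nonneg (√(k t) * |f t|)]

lemma part1_core {δ : ℝ} (hδ : 0 < δ) {k : ℝ → ℝ} {y z : ℝ → Euc d} {R : ℝ} (hR : 0 ≤ R)
    (hk : Continuous k) (hyc : Continuous y) (hz : Measurable z) (hk0 : ∀ t, 0 ≤ k t)
    (hzR : ∀ t, ‖z t‖ ≤ R) (hy : ∀ t, y t = k t • z t) {m : VectorMeasure (XX d) (Euc d)}
    {μ : SignedMeasure (XX d)} {v : XX d → Euc d} {g : XX d → ℝ} (hv : Measurable v)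
    (hg : Measurable g) (hm : IsDensityV m (curveP k z) v) (hμ : IsDensityS μ (curveP k z) g)
    (hce : SolvesCEMeas (curveP k z) m μ) (hE : EnP δ (curveP k z) v g ≠ ⊤)
    {γ : ℝ → Euc d} {h : ℝ → ℝ} (hh : ∀ t ∈ Icc (0:ℝ) 1, h t = k t)
    (hγ : ∀ t ∈ Icc (0:ℝ) 1, 0 < k t → γ t = z t) :
    (∀ᵐ t ∂(volume.restrict {t | t ∈ Ioo (0:ℝ) 1 ∧ 0 < h t}), HasDerivAt γ (v (t, γ t)) t) ∧
    (∀ᵐ t ∂(volume.restrict (Ioo (0:ℝ) 1)), HasDerivAt h (g (t, γ t) * h t) t) ∧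
    AC2 h ∧ AC2 (fun t => Real.sqrt (h t)) ∧ AC2 (fun t => Real.sqrt (h t) • γ t) := by
  have hfin := finite_curveP hk hz
  have hmz : Measurable fun t : ℝ => (t, z t) := measurable_id.prodMk hz
  have hV : Measurable fun t => v (t, z t) := hv.comp hmz
  have hG : Measurable fun t => g (t, z t) := hg.comp hmz
  set V : ℝ → Euc d := fun t => v (t, z t) with hVdef
  set G : ℝ → ℝ := fun t => g (t, z t) with hGdef
  obtain ⟨hV2, hG2⟩ := L2_of_energy hδ hk hk0 hz hv hg hE
  have hVi : IntegrableOn (fun t => k t • V t) (Icc (0:ℝ) 1) := integrableOn_Icc_of_Ioo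
    ((integrable_curveP hk hk0 hz hv.stronglyMeasurable).1 (integrable_of_isDensityV hv hm))
  have hGi : IntegrableOn (fun t => k t * G t) (Icc (0:ℝ) 1) := integrableOn_Icc_of_Ioo
    ((integrable_curveP hk hk0 hz hg.stronglyMeasurable).1 (integrable_of_isDensityS hg hμ))
  have pk : IsPrim k (fun t => G t * k t) := by
    have := prim_of_ce hR hk hyc hz hk0 hzR hy hv hg hm hμ hce 1 0
    simpa using this
  have pa : ∀ a, IsPrim (fun t => inner ℝ a (y t))
      (fun t => k t * inner ℝ a (V t) + G t * inner ℝ a (y t)) := by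
    intro a
    have := prim_of_ce hR hk hyc hz hk0 hzR hy hv hg hm hμ hce 0 a
    simpa using this
  have hyn : ∀ t, ‖y t‖ ≤ R * k t := by
    intro t
    rw [hy, norm_smul, Real.norm_of_nonneg (hk0 t), mul_comm]
    exact mul_le_mul_of_nonneg_right (hzR t) (hk0 t)
  have py : IsPrim y (fun t => k t • V t + G t • y t) := by
    refine IsPrim.of_inner ?_ fun b => ?_
    · refine hVi.add ?_
      refine (hGi.norm.const_mul R).mono' (hG.smul hyc.measurable).aestronglyMeasurable
        (Eventually.of_forall fun t => ?_)
      rw [norm_smul, norm_mul, Real.norm_of_nonneg (hk0 t)]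
      calc ‖G t‖ * ‖y t‖ ≤ ‖G t‖ * (R * k t) := by gcongr; exact hyn t
        _ = R * (k t * ‖G t‖) := by ring
    · simpa only [inner_add_right, inner_smul_right] using pa b
  have hsG : IntegrableOn (fun t => √(k t) * |G t|) (Icc (0:ℝ) 1) :=
    integrableOn_sqrt_mul hk hk0 hG hG2
  have hsV : IntegrableOn (fun t => √(k t) * |‖V t‖|) (Icc (0:ℝ) 1) :=
    integrableOn_sqrt_mul hk hk0 hV.norm hV2
  have ps : IsPrim (fun t => k t / √(k t)) (fun t => √(k t) * 0 + G t * k t / (2 * √(k t))) := by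
    refine sqrt_lemma (C := 1) (fun t _ => hk0 t) zero_le_one
      (fun t _ => by rw [abs_of_nonneg (hk0 t), one_mul]) pk (by simpa using pk) (by simp) hsG
  -- derivative of the vector
  have hd1 : ∀ t, ‖(√(k t))⁻¹ • y t‖ ≤ R * √(k t) := by
    intro t
    rw [norm_smul, norm_inv, Real.norm_of_nonneg (Real.sqrt_nonneg _)]
    rcases (hk0 t).eq_or_lt with h0 | h0
    · simp [← h0]
    · have h1 : 0 < √(k t) := Real.sqrt_pos.2 h0
      calc (√(k t))⁻¹ * ‖y t‖ ≤ (√(k t))⁻¹ * (R * k t) := by gcongr; exact hyn t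
        _ = (√(k t))⁻¹ * (R * (√(k t) * √(k t))) := by rw [Real.mul_self_sqrt (hk0 t)]
        _ = R * √(k t) := by field_simp
  let Q : ℝ → Euc d := fun t => √(k t) • V t + (G t / 2) • ((√(k t))⁻¹ • y t)
  have hQm : Measurable Q := (hk.measurable.sqrt.smul hV).add
    ((hG.div_const 2).smul (hk.measurable.sqrt.inv.smul hyc.measurable))
  have hQn : ∀ t, ‖Q t‖ ≤ √(k t) * ‖V t‖ + R / 2 * (√(k t) * |G t|) := by
    intro t
    refine (norm_add_le _ _).trans ?_
    rw [norm_smul, norm_smul, Real.norm_of_nonneg (Real.sqrt_nonneg _)]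
    refine add_le_add le_rfl ?_
    rw [norm_div, Real.norm_eq_abs, Real.norm_two]
    calc |G t| / 2 * _ ≤ |G t| / 2 * (R * √(k t)) := by gcongr; exact hd1 t
      _ = _ := by ring
  have pq : IsPrim (fun t => (√(k t))⁻¹ • y t) Q := by
    refine IsPrim.of_inner ?_ fun b => ?_
    · refine (hsV.add (hsG.const_mul (R / 2))).mono' hQm.aestronglyMeasurable
        (Eventually.of_forall fun t => ?_)
      simpa [abs_norm] using hQn t
    · have := sqrt_lemma (C := ‖b‖ * R) (y := fun t => inner ℝ b (y t))
        (W := fun t => inner ℝ b (V t)) (fun t _ => hk0 t) (by positivity) ?_ pk (pa b) ?_ hsG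
      · convert this using 2 with t t
        · rw [inner_smul_right]; field_simp
        · simp only [Q, inner_add_right, inner_smul_right]
          ring
      · intro t _
        refine (abs_real_inner_le_norm _ _).trans ?_
        rw [mul_assoc]
        gcongr
        exact hyn t
      · refine (hsV.const_mul ‖b‖).mono' (hk.measurable.sqrt.mul
          (measurable_const.inner hV).abs).aestronglyMeasurable (Eventually.of_forall fun t => ?_)
        rw [Real.norm_of_nonneg (by positivity), abs_norm]
        calc √(k t) * |inner ℝ b (V t)| ≤ √(k t) * (‖b‖ * ‖V t‖) := by
              gcongr; exact abs_real_inner_le_norm _ _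
          _ = _ := by ring
  refine ⟨?_, ?_, ?_, ?_, ?_⟩
  · have hset : {t | t ∈ Ioo (0:ℝ) 1 ∧ 0 < h t} = Ioo 0 1 ∩ {t | 0 < k t} := by
      ext t
      constructor
      · rintro ⟨h1, h2⟩
        exact ⟨h1, by simpa [hh t (Ioo_subset_Icc_self h1)] using h2⟩
      · rintro ⟨h1, h2⟩
        exact ⟨h1, by simpa [hh t (Ioo_subset_Icc_self h1)] using h2⟩
    have hop : IsOpen (Ioo (0:ℝ) 1 ∩ {t | 0 < k t}) :=
      isOpen_Ioo.inter (isOpen_lt continuous_const hk)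
    rw [hset, ae_restrict_iff' hop.measurableSet]
    have h1 := pk.ae_hasDerivAt
    have h2 := py.ae_hasDerivAt
    rw [ae_restrict_iff' measurableSet_Ioo] at h1 h2
    filter_upwards [h1, h2] with t h1 h2 ht
    have hkt : 0 < k t := ht.2
    have h3 := ((h1 ht.1).inv hkt.ne').smul (h2 ht.1)
    have hev : γ =ᶠ[𝓝 t] fun s => (k s)⁻¹ • y s := by
      filter_upwards [hop.mem_nhds ht] with s hs
      rw [hγ s (Ioo_subset_Icc_self hs.1) hs.2, hy, smul_smul, inv_mul_cancel₀ (ne_of_gt hs.2),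
        one_smul]
    rw [hγ t (Ioo_subset_Icc_self ht.1) ht.2]
    refine HasDerivAt.congr_of_eventuallyEq ?_ hev
    convert h3 using 1
    · rfl
    simp only [Pi.inv_apply, smul_add, smul_smul, inv_mul_cancel₀ hkt.ne', one_smul]
    rw [add_assoc, ← add_smul]
    have : (k t)⁻¹ * G t + -(G t * k t) / k t ^ 2 = 0 := by field_simp; ring
    rw [this, zero_smul, add_zero]
  · have h1 := pk.ae_hasDerivAt
    filter_upwards [h1, ae_restrict_mem measurableSet_Ioo] with t h1 ht
    have hev : h =ᶠ[𝓝 t] k := by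
      filter_upwards [isOpen_Ioo.mem_nhds ht] with s hs
      exact hh s (Ioo_subset_Icc_self hs)
    refine HasDerivAt.congr_of_eventuallyEq ?_ hev
    rw [hh t (Ioo_subset_Icc_self ht)]
    rcases (hk0 t).eq_or_lt with h0 | h0
    · simpa [← h0] using h1
    · rw [hγ t (Ioo_subset_Icc_self ht) h0]; exact h1
  · have p := pk.congr (g := h) (fun t ht => (hh t ht).symm) (Eventually.of_forall fun _ => rfl)
    refine ⟨_, p.1, ?_, p.2⟩
    obtain ⟨C, hC⟩ := isCompact_Icc.exists_bound_of_continuousOn (hk.continuousOn (s := Icc (0:ℝ) 1))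
    refine (hG2.const_mul C).mono' ((hG.mul hk.measurable).norm.pow_const 2).aestronglyMeasurable ?_
    filter_upwards [ae_restrict_mem measurableSet_Icc] with t ht
    have hCt := hC t ht
    rw [Real.norm_of_nonneg (hk0 t)] at hCt
    rw [Real.norm_of_nonneg (by positivity), Real.norm_eq_abs, sq_abs]
    calc (G t * k t) ^ 2 = k t * (k t * G t ^ 2) := by ring
      _ ≤ C * (k t * G t ^ 2) := by
        have := hk0 t
        gcongr
  · have p := ps.congr (g := fun t => √(h t)) (fun t ht => by rw [hh t ht, Real.div_sqrt])
      (Eventually.of_forall fun _ => rfl)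
    refine ⟨_, p.1, ?_, p.2⟩
    refine hG2.mono' ((((hk.measurable.sqrt.mul_const 0).add ((hG.mul hk.measurable).div
      (hk.measurable.sqrt.const_mul 2))).norm.pow_const 2)).aestronglyMeasurable ?_
    refine Eventually.of_forall fun t => ?_
    rw [Real.norm_of_nonneg (by positivity), Real.norm_eq_abs, sq_abs, mul_zero, zero_add]
    rcases (hk0 t).eq_or_lt with h0 | h0
    · simp [← h0]
    · have e : (G t * k t / (2 * √(k t))) ^ 2 = k t * G t ^ 2 / 4 := by
        rw [div_pow, mul_pow, mul_pow, Real.sq_sqrt h0.le]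
        field_simp
        norm_num
      rw [e]
      have : 0 ≤ k t * G t ^ 2 := by positivity
      linarith
  · have p := pq.congr (g := fun t => √(h t) • γ t) (fun t ht => by
      rw [hh t ht]
      rcases (hk0 t).eq_or_lt with h0 | h0
      · simp [← h0]
      · rw [hγ t ht h0, hy, smul_smul, inv_mul_eq_div, Real.div_sqrt])
      (Eventually.of_forall fun _ => rfl)
    refine ⟨_, p.1, ?_, p.2⟩
    refine ((hV2.const_mul 2).add (hG2.const_mul (R ^ 2 / 2))).mono'
      (hQm.norm.pow_const 2).aestronglyMeasurable (Eventually.of_forall fun t => ?_)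
    rw [Real.norm_of_nonneg (by positivity)]
    have h1 := hQn t
    have e : (√(k t)) ^ 2 = k t := Real.sq_sqrt (hk0 t)
    calc ‖Q t‖ ^ 2 ≤ (√(k t) * ‖V t‖ + R / 2 * (√(k t) * |G t|)) ^ 2 := by gcongr
      _ ≤ 2 * ((√(k t)) ^ 2 * ‖V t‖ ^ 2) + R ^ 2 / 2 * ((√(k t)) ^ 2 * |G t| ^ 2) := by
        nlinarith [sq_nonneg (√(k t) * ‖V t‖ - R / 2 * (√(k t) * |G t|))]
      _ = _ := by rw [e, sq_abs]; rfl

lemma part1 {V : Set (Euc d)} (hVb : Bornology.IsBounded V) {α β δ : ℝ} (hα : 0 < α) (hβ : 0 < β)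
    (hδ : 0 < δ) {η : SCurve V} {γ : ℝ → Euc d} {h : ℝ → ℝ} (hrep : Represents η γ h)
    {P : Measure (XX d)} {m : VectorMeasure (XX d) (Euc d)}
    {μ : SignedMeasure (XX d)} (hP : CurveMeasure η P) (hJ : JMeas α β δ P m μ ≠ ⊤) :
        ∃ (v : XX d → Euc d) (g : XX d → ℝ),
          Measurable v ∧ Measurable g ∧
          (∀ s : Set (XX d), MeasurableSet s → m s = ∫ x in s, v x ∂P) ∧
          (∀ s : Set (XX d), MeasurableSet s → μ s = ∫ x in s, g x ∂P) ∧
          (∀ᵐ t ∂(volume.restrict {t | t ∈ Ioo (0:ℝ) 1 ∧ 0 < h t}),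
            HasDerivAt γ (v (t, γ t)) t) ∧
          (∀ᵐ t ∂(volume.restrict (Ioo (0:ℝ) 1)),
            HasDerivAt h (g (t, γ t) * h t) t) ∧
          AC2 h ∧ AC2 (fun t => Real.sqrt (h t)) ∧
          AC2 (fun t => Real.sqrt (h t) • γ t) ∧
          JMeas α β δ P m μ
            = ∫⁻ t in {t | t ∈ Ioo (0:ℝ) 1 ∧ 0 < h t},
                ENNReal.ofReal (β / 2 * ‖v (t, γ t)‖ ^ 2 * h t
                  + β * δ ^ 2 / 2 * (g (t, γ t) * h t) ^ 2 / h t + α * h t) := by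
  obtain ⟨k, y, z, R, hR, hk, hyc, hz, hk0, hzR, hy, hh, hγ, rfl⟩ := curve_data hVb hrep hP
  have hfin := finite_curveP hk hz
  have hce : SolvesCEMeas (curveP k z) m μ := by
    by_contra hne
    exact hJ (if_neg hne)
  have hJe : JMeas α β δ (curveP k z) m μ = ENNReal.ofReal β * BdeltaMeas δ (curveP k z) m μ
      + ENNReal.ofReal α * curveP k z univ := if_pos hce
  have hB : BdeltaMeas δ (curveP k z) m μ ≠ ⊤ := by
    intro hB
    apply hJ
    rw [hJe, hB, ENNReal.mul_top (by simpa using hβ), top_add]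
  obtain ⟨v, g, hv, hg, hm, hμ⟩ := exists_velocity hB
  have hBe : BdeltaMeas δ (curveP k z) m μ = EnP δ (curveP k z) v g := Bdelta_eq hv hg hm hμ
  rw [hBe] at hB
  obtain ⟨h1, h2, h3, h4, h5⟩ :=
    part1_core hδ hR hk hyc hz hk0 hzR hy hv hg hm hμ hce hB hh hγ
  refine ⟨v, g, hv, hg, hm, hμ, h1, h2, h3, h4, h5, ?_⟩
  rw [hJe, hBe]
  exact J_formula hα hβ hk hk0 hz hv hg hh hγ

/-! ### The converse -/

lemma AC2.exists_measurable {F : Type*} [NormedAddCommGroup F] [NormedSpace ℝ F]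
    [MeasurableSpace F] [BorelSpace F] {f f₁ : ℝ → F}
    (hf : AC2 f) (h : ∀ t ∈ Icc (0:ℝ) 1, f t = f₁ t) :
    ∃ f' : ℝ → F, Measurable f' ∧ IsPrim f₁ f' ∧
      IntegrableOn (fun t => ‖f' t‖ ^ 2) (Icc (0:ℝ) 1) := by
  obtain ⟨f', h1, h2, h3⟩ := hf
  have hm := h1.aestronglyMeasurable
  have hae := hm.ae_eq_mk
  refine ⟨hm.mk f', hm.stronglyMeasurable_mk.measurable, ?_, ?_⟩
  · have hp : IsPrim f f' := ⟨h1, h3⟩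
    refine hp.congr h ?_
    rw [restrict_Ioo_eq_restrict_Icc]
    exact hae
  · refine h2.congr ?_
    filter_upwards [hae] with t ht
    rw [ht]

lemma part2 {V : Set (Euc d)} (hVb : Bornology.IsBounded V) {α β δ : ℝ} (hα : 0 < α) (hβ : 0 < β)
    {η : SCurve V} {γ : ℝ → Euc d} {h : ℝ → ℝ} {γ' : ℝ → Euc d} {h' : ℝ → ℝ}
    (hrep : Represents η γ h) (hs : AC2 (fun t => Real.sqrt (h t)))
    (hsγ : AC2 (fun t => Real.sqrt (h t) • γ t)) (hder : HasAEDerivs γ h γ' h')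
    {P : Measure (XX d)} {m : VectorMeasure (XX d) (Euc d)}
    {μ : SignedMeasure (XX d)} (hP : CurveMeasure η P)
    (hm : ∀ s : Set (XX d), MeasurableSet s →
          m s = ∫ t in Ioo (0:ℝ) 1,
            Set.indicator {u : ℝ | (u, γ u) ∈ s} (fun u => h u • γ' u) t)
    (hμ : ∀ s : Set (XX d), MeasurableSet s →
          μ s = ∫ t in Ioo (0:ℝ) 1, Set.indicator {u : ℝ | (u, γ u) ∈ s} h' t) :
        SolvesCEMeas P m μ ∧ JMeas α β δ P m μ ≠ ⊤ ∧
        JMeas α β δ P m μ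
          = ∫⁻ t in {t | t ∈ Ioo (0:ℝ) 1 ∧ 0 < h t},
              ENNReal.ofReal (β / 2 * ‖γ' t‖ ^ 2 * h t
                + β * δ ^ 2 / 2 * h' t ^ 2 / h t + α * h t) := by
  obtain ⟨k, y, z, R, hR, hk, hyc, hz, hk0, hzR, hy, hh, hγ, rfl⟩ := curve_data hVb hrep hP
  have hfin := finite_curveP hk hz
  obtain ⟨p', hp'm, hpP, hp2⟩ := hs.exists_measurable (f₁ := fun t => √(k t))
    (fun t ht => by rw [hh t ht])
  obtain ⟨q', hq'm, hqP, hq2⟩ := hsγ.exists_measurable (f₁ := fun t => √(k t) • z t)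
    (fun t ht => by
      rw [hh t ht]
      rcases (hk0 t).eq_or_lt with h0 | h0
      · simp [← h0]
      · rw [hγ t ht h0])
  have hpp : ∀ t, √(k t) * √(k t) = k t := fun t => Real.mul_self_sqrt (hk0 t)
  have hppos : ∀ t, 0 < k t → 0 < √(k t) := fun t => Real.sqrt_pos.2
  let vt : ℝ → Euc d := fun t => (√(k t))⁻¹ • (q' t - p' t • z t)
  let gt : ℝ → ℝ := fun t => 2 * p' t / √(k t)
  have hvtm : Measurable vt := hk.measurable.sqrt.inv.smul (hq'm.sub (hp'm.smul hz))
  have hgtm : Measurable gt := (hp'm.const_mul 2).div hk.measurable.sqrt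
  let v : XX d → Euc d := fun x => vt x.1
  let g : XX d → ℝ := fun x => gt x.1
  have hv : Measurable v := hvtm.comp measurable_fst
  have hg : Measurable g := hgtm.comp measurable_fst
  have hset : {t | t ∈ Ioo (0:ℝ) 1 ∧ 0 < h t} = Ioo 0 1 ∩ {t | 0 < k t} := by
    ext t
    constructor
    · rintro ⟨h1, h2⟩
      exact ⟨h1, by simpa [hh t (Ioo_subset_Icc_self h1)] using h2⟩
    · rintro ⟨h1, h2⟩
      exact ⟨h1, by simpa [hh t (Ioo_subset_Icc_self h1)] using h2⟩
  have hop : IsOpen (Ioo (0:ℝ) 1 ∩ {t | 0 < k t}) :=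
    isOpen_Ioo.inter (isOpen_lt continuous_const hk)
  have hh' : ∀ᵐ t ∂(volume.restrict (Ioo (0:ℝ) 1)), h' t = 2 * √(k t) * p' t := by
    filter_upwards [hder.1, hpP.ae_hasDerivAt, ae_restrict_mem measurableSet_Ioo] with t h1 h2 ht
    have hev : h =ᶠ[𝓝 t] fun s => √(k s) * √(k s) := by
      filter_upwards [isOpen_Ioo.mem_nhds ht] with s hs
      rw [hh s (Ioo_subset_Icc_self hs), hpp]
    have h3 := (h2.mul h2).congr_of_eventuallyEq hev
    rw [h1.unique h3]
    ring
  have hγ' : ∀ᵐ t ∂(volume.restrict (Ioo (0:ℝ) 1)), 0 < k t → γ' t = vt t := by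
    have h1 := hder.2
    have h2 := hpP.ae_hasDerivAt
    have h3 := hqP.ae_hasDerivAt
    rw [hset, ae_restrict_iff' hop.measurableSet] at h1
    rw [ae_restrict_iff' measurableSet_Ioo] at h2 h3 ⊢
    filter_upwards [h1, h2, h3] with t h1 h2 h3 ht hkt
    have hp0 := hppos t hkt
    have h4 := ((h2 ht).inv hp0.ne').smul (h3 ht)
    have hev : γ =ᶠ[𝓝 t] (fun s => √(k s))⁻¹ • fun s => √(k s) • z s := by
      filter_upwards [hop.mem_nhds ⟨ht, hkt⟩] with s hs
      have := hppos s hs.2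
      rw [hγ s (Ioo_subset_Icc_self hs.1) hs.2]
      show _ = (√(k s))⁻¹ • (√(k s) • z s)
      rw [smul_smul, inv_mul_cancel₀ this.ne', one_smul]
    have h5 := h4.congr_of_eventuallyEq hev
    rw [(h1 ⟨ht, hkt⟩).unique h5]
    show (√(k t))⁻¹ • q' t + (-p' t / √(k t) ^ 2) • (√(k t) • z t)
      = (√(k t))⁻¹ • (q' t - p' t • z t)
    rw [smul_sub, smul_smul, smul_smul, sub_eq_add_neg, ← neg_smul]
    congr 2
    field_simp
  have hkv : ∀ t, k t • vt t = √(k t) • q' t - p' t • (√(k t) • z t) := by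
    intro t
    rcases (hk0 t).eq_or_lt with h0 | h0
    · simp [← h0]
    · have := hppos t h0
      conv_lhs => rw [← hpp t]
      simp only [vt]
      rw [mul_smul, smul_smul (√(k t)) (√(k t))⁻¹, mul_inv_cancel₀ this.ne', one_smul, smul_sub,
        smul_comm]
  have hkg : ∀ t, k t * gt t = 2 * √(k t) * p' t := by
    intro t
    rcases (hk0 t).eq_or_lt with h0 | h0
    · simp [← h0]
    · have := hppos t h0
      conv_lhs => rw [← hpp t]
      simp only [gt]
      field_simp
  have hmd : IsDensityV m (curveP k z) v := by
    intro s hs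
    rw [hm s hs, ← integral_indicator hs, integral_curveP hk hk0 hz
      (hv.stronglyMeasurable.indicator hs)]
    refine integral_congr_ae ?_
    filter_upwards [hγ', ae_restrict_mem measurableSet_Ioo] with t h1 ht
    have ht' := Ioo_subset_Icc_self ht
    rcases (hk0 t).eq_or_lt with h0 | h0
    · simp [indicator, hh t ht', ← h0]
    · by_cases hts : (t, z t) ∈ s
      · rw [indicator_of_mem hts, indicator_of_mem (show t ∈ {u : ℝ | (u, γ u) ∈ s} by
          show (t, γ t) ∈ s
          rw [hγ t ht' h0]; exact hts), hh t ht', h1 h0]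
      · rw [indicator_of_notMem hts, indicator_of_notMem (show t ∉ {u : ℝ | (u, γ u) ∈ s} by
          show ¬ (t, γ t) ∈ s
          rw [hγ t ht' h0]; exact hts), smul_zero]
  have hμd : IsDensityS μ (curveP k z) g := by
    intro s hs
    rw [hμ s hs, ← integral_indicator hs, integral_curveP hk hk0 hz
      (hg.stronglyMeasurable.indicator hs)]
    refine integral_congr_ae ?_
    filter_upwards [hh', ae_restrict_mem measurableSet_Ioo] with t h1 ht
    have ht' := Ioo_subset_Icc_self ht
    rcases (hk0 t).eq_or_lt with h0 | h0
    · rw [← h0] at h1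
      simp only [Real.sqrt_zero, mul_zero, zero_mul] at h1
      simp [indicator, h1, ← h0]
    · by_cases hts : (t, z t) ∈ s
      · rw [indicator_of_mem hts, indicator_of_mem (show t ∈ {u : ℝ | (u, γ u) ∈ s} by
          show (t, γ t) ∈ s
          rw [hγ t ht' h0]; exact hts), h1, smul_eq_mul, ← hkg]
      · rw [indicator_of_notMem hts, indicator_of_notMem (show t ∉ {u : ℝ | (u, γ u) ∈ s} by
          show ¬ (t, γ t) ∈ s
          rw [hγ t ht' h0]; exact hts), smul_zero]
  have hvi := integrable_of_isDensityV hv hmd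
  have hgi := integrable_of_isDensityS hg hμd
  have hce : SolvesCEMeas (curveP k z) m μ := by
    intro lam hlam w u hw hu hwd hud φ hφ
    obtain ⟨M, hM0, hM1, hM2⟩ := hφ.bounds
    rw [integral_clm_eq_of_density (integrable_of_isDensityV hw hwd) hvi
        (hφ.1.continuous_fderiv (by simp)) hM2 (fun s hs => by rw [← hwd s hs, ← hmd s hs]),
      integral_mul_eq_of_density (integrable_of_isDensityS hu hud) hgi
        hφ.1.continuous.measurable hM1 (fun s hs => by rw [← hud s hs, ← hμd s hs]),
      ce_curve hk hk0 hz hv hg hvi hgi hφ]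
    refine Eq.trans ?_ (ce_1d hφ hpP hqP (fun t _ => Real.sqrt_nonneg _)
      (fun t _ h0 => by simp only [h0, zero_smul]))
    refine intervalIntegral.integral_congr fun t _ => ?_
    rw [← hkv t, ← hkg t]
    rcases (hk0 t).eq_or_lt with h0 | h0
    · have hzz : ((0:ℝ), (0 : Euc d)) = 0 := rfl
      simp [← h0, hzz]
    · have := hppos t h0
      rw [smul_smul, inv_mul_cancel₀ this.ne', one_smul, Real.sq_sqrt h0.le]
      have e : (((0:ℝ), k t • vt t) : XX d) = k t • ((0:ℝ), vt t) := by
        ext <;> simp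
      rw [e, map_smul, smul_eq_mul]
      simp only [v, g]
      ring
  have hJe : JMeas α β δ (curveP k z) m μ = ENNReal.ofReal β * EnP δ (curveP k z) v g
      + ENNReal.ofReal α * curveP k z univ := by
    rw [← Bdelta_eq hv hg hmd hμd]
    exact if_pos hce
  have hEf : EnP δ (curveP k z) v g ≠ ⊤ := by
    have hEm : Measurable fun x : XX d => ENNReal.ofReal ((‖v x‖ ^ 2 + δ ^ 2 * g x ^ 2) / 2) :=
      (((hv.norm.pow_const 2).add ((hg.pow_const 2).const_mul _)).div_const 2).ennreal_ofReal
    rw [EnP, lintegral_curveP hk hz hEm]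
    have hI : IntegrableOn (fun t => ‖q' t‖ ^ 2 + (R ^ 2 + 2 * δ ^ 2) * ‖p' t‖ ^ 2) (Ioo (0:ℝ) 1) :=
      (hq2.add (hp2.const_mul _)).mono_set Ioo_subset_Icc_self
    refine ((lintegral_mono fun t => ?_).trans_lt hI.lintegral_lt_top).ne
    rw [← ENNReal.ofReal_mul (hk0 t)]
    apply ENNReal.ofReal_le_ofReal
    rcases (hk0 t).eq_or_lt with h0 | h0
    · rw [← h0, zero_mul]; positivity
    · have hp0 := hppos t h0
      have e1 : k t * ‖vt t‖ ^ 2 = ‖q' t - p' t • z t‖ ^ 2 := by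
        simp only [vt]
        rw [norm_smul, norm_inv, Real.norm_of_nonneg hp0.le, mul_pow, inv_pow, Real.sq_sqrt h0.le]
        field_simp
      have e2 : k t * gt t ^ 2 = 4 * ‖p' t‖ ^ 2 := by
        simp only [gt]
        rw [div_pow, Real.sq_sqrt h0.le, Real.norm_eq_abs, sq_abs]
        field_simp
        ring
      have e3 : ‖q' t - p' t • z t‖ ≤ ‖q' t‖ + ‖p' t‖ * R := by
        refine (norm_sub_le _ _).trans ?_
        rw [norm_smul]
        gcongr
        exact hzR t
      have e4 : ‖q' t - p' t • z t‖ ^ 2 ≤ (‖q' t‖ + ‖p' t‖ * R) ^ 2 := by gcongr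
      show k t * ((‖vt t‖ ^ 2 + δ ^ 2 * gt t ^ 2) / 2) ≤ _
      have e5 : k t * ((‖vt t‖ ^ 2 + δ ^ 2 * gt t ^ 2) / 2)
        = (k t * ‖vt t‖ ^ 2 + δ ^ 2 * (k t * gt t ^ 2)) / 2 := by ring
      rw [e5, e1, e2]
      nlinarith [sq_nonneg (‖q' t‖ - ‖p' t‖ * R)]
  refine ⟨hce, ?_, ?_⟩
  · rw [hJe]
    exact ENNReal.add_ne_top.2 ⟨ENNReal.mul_ne_top ENNReal.ofReal_ne_top hEf,
      ENNReal.mul_ne_top ENNReal.ofReal_ne_top (measure_ne_top _ _)⟩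
  · rw [hJe, J_formula hα hβ hk hk0 hz hv hg hh hγ]
    refine lintegral_congr_ae ?_
    rw [hset]
    have hsub : volume.restrict (Ioo (0:ℝ) 1 ∩ {t | 0 < k t}) ≤ volume.restrict (Ioo (0:ℝ) 1) :=
      Measure.restrict_mono inter_subset_left le_rfl
    filter_upwards [ae_mono hsub hh', ae_mono hsub hγ', ae_restrict_mem hop.measurableSet]
      with t h1 h2 ht
    have e1 : v (t, γ t) = γ' t := (h2 ht.2).symm
    have e2 : g (t, γ t) * h t = h' t := by
      rw [hh t (Ioo_subset_Icc_self ht.1), h1, ← hkg, mul_comm]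
    rw [e1, e2]

/-- **Structure of finite-energy cone curves.**
If `ρ_t = h(t)δ_{γ(t)} ∈ 𝒮_V` and `(m,μ)` satisfy `J_{α,β,δ}(ρ,m,μ) < ∞`, then
`m = vρ`, `μ = gρ` for measurable `v,g`, the curve solves the characteristic
system, belongs to `H_V`, and the energy is given by the explicit formula.
Conversely every `ρ ∈ H_V` together with `m = hγ' dt⊗δ_γ`, `μ = h' dt⊗δ_γ`
solves the continuity equation with finite energy given by the same formula. -/
theorem finite_energy_cone_curves (d : ℕ) (hd : 1 ≤ d) (V : Set (Euc d))
    (hV : IsClosureOfBoundedDomain V)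
    (α β δ : ℝ) (hα : 0 < α) (hβ : 0 < β) (hδ : 0 < δ) :
    (∀ (η : SCurve V) (γ : ℝ → Euc d) (h : ℝ → ℝ), Represents η γ h →
      ∀ (P : Measure (XX d)) (m : VectorMeasure (XX d) (Euc d))
        (μ : SignedMeasure (XX d)), CurveMeasure η P →
        JMeas α β δ P m μ ≠ ⊤ →
        ∃ (v : XX d → Euc d) (g : XX d → ℝ),
          Measurable v ∧ Measurable g ∧
          (∀ s : Set (XX d), MeasurableSet s → m s = ∫ x in s, v x ∂P) ∧
          (∀ s : Set (XX d), MeasurableSet s → μ s = ∫ x in s, g x ∂P) ∧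
          (∀ᵐ t ∂(volume.restrict {t | t ∈ Ioo (0:ℝ) 1 ∧ 0 < h t}),
            HasDerivAt γ (v (t, γ t)) t) ∧
          (∀ᵐ t ∂(volume.restrict (Ioo (0:ℝ) 1)),
            HasDerivAt h (g (t, γ t) * h t) t) ∧
          AC2 h ∧ AC2 (fun t => Real.sqrt (h t)) ∧
          AC2 (fun t => Real.sqrt (h t) • γ t) ∧
          JMeas α β δ P m μ
            = ∫⁻ t in {t | t ∈ Ioo (0:ℝ) 1 ∧ 0 < h t},
                ENNReal.ofReal (β / 2 * ‖v (t, γ t)‖ ^ 2 * h t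
                  + β * δ ^ 2 / 2 * (g (t, γ t) * h t) ^ 2 / h t + α * h t)) ∧
    (∀ (η : SCurve V) (γ : ℝ → Euc d) (h : ℝ → ℝ) (γ' : ℝ → Euc d) (h' : ℝ → ℝ),
      Represents η γ h → AC2 h → AC2 (fun t => Real.sqrt (h t)) →
      AC2 (fun t => Real.sqrt (h t) • γ t) → HasAEDerivs γ h γ' h' →
      ∀ (P : Measure (XX d)) (m : VectorMeasure (XX d) (Euc d))
        (μ : SignedMeasure (XX d)), CurveMeasure η P →
        (∀ s : Set (XX d), MeasurableSet s →
          m s = ∫ t in Ioo (0:ℝ) 1,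
            Set.indicator {u : ℝ | (u, γ u) ∈ s} (fun u => h u • γ' u) t) →
        (∀ s : Set (XX d), MeasurableSet s →
          μ s = ∫ t in Ioo (0:ℝ) 1, Set.indicator {u : ℝ | (u, γ u) ∈ s} h' t) →
        SolvesCEMeas P m μ ∧ JMeas α β δ P m μ ≠ ⊤ ∧
        JMeas α β δ P m μ
          = ∫⁻ t in {t | t ∈ Ioo (0:ℝ) 1 ∧ 0 < h t},
              ENNReal.ofReal (β / 2 * ‖γ' t‖ ^ 2 * h t
                + β * δ ^ 2 / 2 * h' t ^ 2 / h t + α * h t)) := by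
  obtain ⟨U, _, _, _, hUb, rfl⟩ := hV
  have hVb := hUb.closure
  exact ⟨fun η γ h hrep P m μ hP hJ => part1 hVb hα hβ hδ hrep hP hJ,
    fun η γ h γ' h' hrep _ hs hsγ hder P m μ hP hm hμ =>
      part2 hVb hα hβ hrep hs hsγ hder hP hm hμ⟩

end Paper
end
end
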